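/- For every positive integer n, the crossing number of the complete tripartite graph K_{1,4,n} equals Z(5,n+1) − 2⌊n/2⌋. -/

import Mathlib

open SimpleGraph

variable {V : Type*}

/-- A drawing of a simple graph in the plane: an injective placement of the
vertices in `ℝ²` together with, for each edge, a continuous arc joining the
positions of its endpoints (parametrised compatibly in both directions),
such that no arc passes through the position of a vertex other than its
endpoints. -/
structure Drawing (G : SimpleGraph V) where
  pos : V → ℝ × ℝ
  pos_inj : Function.Injective pos
  arc : V → V → ℝ → ℝ × ℝ
  arc_cont : ∀ ⦃a b⦄, G.Adj a b → ContinuousOn (arc a b) (Set.Icc 0 1)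
  arc_zero : ∀ ⦃a b⦄, G.Adj a b → arc a b 0 = pos a
  arc_one : ∀ ⦃a b⦄, G.Adj a b → arc a b 1 = pos b
  arc_symm : ∀ ⦃a b⦄, G.Adj a b → ∀ t, arc b a t = arc a b (1 - t)
  arc_avoid : ∀ ⦃a b⦄, G.Adj a b → ∀ c, c ≠ a → c ≠ b →
      pos c ∉ arc a b '' Set.Icc 0 1

namespace Drawing

variable {G : SimpleGraph V} (D : Drawing G)

/-- The set of points of the plane used by the edge `e`. -/
def edgePoints (e : Sym2 V) : Set (ℝ × ℝ) :=
  {p | ∃ a b, e = s(a, b) ∧ G.Adj a b ∧ p ∈ D.arc a b '' Set.Icc 0 1}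

/-- The positions of the endpoints of an edge. -/
def ends (e : Sym2 V) : Set (ℝ × ℝ) := {p | ∃ a ∈ e, p = D.pos a}

/-- `p` is a crossing of the (distinct) edges `e` and `f` in the drawing `D`:
a common point of the two edges other than an endpoint. -/
def IsCrossing (e f : Sym2 V) (p : ℝ × ℝ) : Prop :=
  e ∈ G.edgeSet ∧ f ∈ G.edgeSet ∧ e ≠ f ∧
    p ∈ D.edgePoints e ∧ p ∈ D.edgePoints f ∧ p ∉ D.ends e ∧ p ∉ D.ends f

/-- The crossings between an edge of `A` and an edge of `B`: a crossing is
recorded as a point of the plane together with the unordered pair of edges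
crossing there. -/
def crossings (A B : Set (Sym2 V)) : Set ((ℝ × ℝ) × Sym2 (Sym2 V)) :=
  {q | ∃ e f, q.2 = s(e, f) ∧ e ∈ A ∧ f ∈ B ∧ D.IsCrossing e f q.1}

/-- `cr_D(A, B)`: the number of crossings between an edge of `A` and an
edge of `B`. -/
noncomputable def crBetween (A B : Set (Sym2 V)) : ℕ := Nat.card (D.crossings A B)

/-- `cr(D)`: the total number of crossings of the drawing `D`. -/
noncomputable def crNum : ℕ := D.crBetween G.edgeSet G.edgeSet

/-- A good drawing: no edge crosses itself (each arc is a simple arc),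
no two adjacent edges cross, no two edges cross more than once, and no three
edges cross at a common point. -/
structure IsGood : Prop where
  arc_inj : ∀ ⦃a b⦄, G.Adj a b → Set.InjOn (D.arc a b) (Set.Icc 0 1)
  adj_no_cross : ∀ e f : Sym2 V, (∃ a, a ∈ e ∧ a ∈ f) → ∀ p, ¬ D.IsCrossing e f p
  cross_once : ∀ e f : Sym2 V, {p | D.IsCrossing e f p}.Subsingleton
  no_triple : ∀ p, ∀ e f g : Sym2 V, e ≠ f → e ≠ g → f ≠ g →
      ¬ (D.IsCrossing e f p ∧ D.IsCrossing f g p ∧ D.IsCrossing e g p)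

end Drawing

/-- The crossing number of a graph: the minimum number of crossings among
all good drawings of `G` in the plane. -/
noncomputable def crossingNumber (G : SimpleGraph V) : ℕ :=
  sInf {n | ∃ D : Drawing G, D.IsGood ∧ D.crNum = n}

/-- The Zarankiewicz function `Z(m,n) = ⌊m/2⌋⌊(m-1)/2⌋⌊n/2⌋⌊(n-1)/2⌋`. -/
def Z (m n : ℕ) : ℕ := m / 2 * ((m - 1) / 2) * (n / 2) * ((n - 1) / 2)

/-- The complete bipartite graph `K_{a,b}`. -/
abbrev bipK (a b : ℕ) : SimpleGraph (Fin a ⊕ Fin b) :=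
  completeBipartiteGraph (Fin a) (Fin b)

/-- The complete tripartite graph `K_{a,b,c}`. -/
abbrev triK (a b c : ℕ) : SimpleGraph (Σ i : Fin 3, ![Fin a, Fin b, Fin c] i) :=
  completeMultipartiteGraph ![Fin a, Fin b, Fin c]

/-- The complete 4-partite graph `K_{a,b,c,d}`. -/
abbrev quadK (a b c d : ℕ) : SimpleGraph (Σ i : Fin 4, ![Fin a, Fin b, Fin c, Fin d] i) :=
  completeMultipartiteGraph ![Fin a, Fin b, Fin c, Fin d]

/-- `E(V₁, V₂)`: the set of pairs `{v₁, v₂}` with `v₁ ∈ V₁` and `v₂ ∈ V₂`. -/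
def pairEdges {α : Type*} (V₁ V₂ : Set α) : Set (Sym2 α) :=
  {e | ∃ a ∈ V₁, ∃ b ∈ V₂, e = s(a, b)}


namespace Topo
open Complex Set

theorem const_diff {L M : ℝ → ℂ} {p q : ℝ} (hpq : p ≤ q)
    (hL : ContinuousOn L (Icc p q)) (hM : ContinuousOn M (Icc p q))
    (h : ∀ t ∈ Icc p q, exp (L t) = exp (M t)) : L q - L p = M q - M p := by
  -- choose the lift
  let F : Icc p q → ℂ := fun t => L t - M t
  have hF : Continuous F := by
    exact Continuous.sub hL.domRestrict hM.domRestrict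
  have : PreconnectedSpace (Icc p q) := Subtype.preconnectedSpace isPreconnected_Icc
  let n : Icc p q → ℂ := fun t => F t / (2 * Real.pi * I)
  have hn : Continuous n := by fun_prop
  have h2 : (2 * Real.pi * I : ℂ) ≠ 0 := by simp [Real.pi_ne_zero]
  have h_integer : ∀ t, ∃ k : ℤ, n t = k := by
    intro t
    obtain ⟨k, hk⟩ := Complex.exp_eq_exp_iff_exists_int.1 (h t t.2)
    refine ⟨k, ?_⟩
    simp only [n, F, hk]
    field_simp
    ring
  have hre : ∀ s t, n s = n t := by
    choose k hk using h_integer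
    have hkc : Continuous k := by
      rw [continuous_iff_continuousAt]
      intro s
      have h1 : Continuous fun t => (n t).re := by fun_prop
      have h3 := (Metric.continuous_iff.1 h1) s 1 one_pos
      obtain ⟨δ, hδ, h4⟩ := h3
      apply ContinuousAt.congr (f := fun _ => k s) continuousAt_const
      filter_upwards [Metric.ball_mem_nhds s hδ] with t ht
      have := h4 t ht
      rw [hk, hk, Real.dist_eq] at this
      simp only [intCast_re] at this
      have h5 : |k t - k s| < 1 := by exact_mod_cast this
      rw [Int.abs_lt_one_iff] at h5
      omega
    intro s t
    rw [hk, hk, PreconnectedSpace.constant this hkc (x := s) (y := t)]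
  have := hre ⟨p, left_mem_Icc.2 hpq⟩ ⟨q, right_mem_Icc.2 hpq⟩
  simp only [n, F] at this
  rw [div_left_inj' h2] at this
  linear_combination -this

/-- existence of lifts on a rectangle -/
theorem lift_rect {H : ℝ → ℝ → ℂ} {p q p' q' : ℝ} (h : p ≤ q) (h' : p' ≤ q')
    (hc : ContinuousOn (Function.uncurry H) (Icc p q ×ˢ Icc p' q'))
    (hz : ∀ s ∈ Icc p q, ∀ t ∈ Icc p' q', H s t ≠ 0) :
    ∃ F : ℝ → ℝ → ℂ, Continuous (Function.uncurry F) ∧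
      ∀ s ∈ Icc p q, ∀ t ∈ Icc p' q', exp (F s t) = H s t := by
  let g : ℝ × ℝ → ℂ := fun z => H (projIcc p q h z.1) (projIcc p' q' h' z.2)
  have hg : Continuous g := by
    have : Continuous fun z : ℝ × ℝ => ((projIcc p q h z.1 : ℝ), (projIcc p' q' h' z.2 : ℝ)) := by
      have h1 := continuous_projIcc (h := h)
      have h2 := continuous_projIcc (h := h')
      fun_prop
    exact hc.comp_continuous this (fun z => ⟨Subtype.coe_prop _, Subtype.coe_prop _⟩)
  have hg0 : ∀ z, g z ∈ ({0}ᶜ : Set ℂ) := fun z =>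
    hz _ (Subtype.coe_prop _) _ (Subtype.coe_prop _)
  obtain ⟨F, ⟨-, hF⟩, -⟩ := Complex.isCoveringMapOn_exp.existsUnique_continuousMap_lifts
    (⟨g, hg⟩ : C(ℝ × ℝ, ℂ)) (a₀ := (0, 0)) (e₀ := Complex.log (g (0, 0)))
    (Complex.exp_log (hg0 _)) hg0
  refine ⟨fun s t => F (s, t), F.continuous, ?_⟩
  intro s hs t ht
  have := congrFun hF (s, t)
  simp only [Function.comp, ContinuousMap.coe_mk, g] at this
  rw [this, projIcc_of_mem h hs, projIcc_of_mem h' ht]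

theorem lift_line {f : ℝ → ℂ} {p q : ℝ} (h : p ≤ q) (hc : ContinuousOn f (Icc p q))
    (hz : ∀ t ∈ Icc p q, f t ≠ 0) :
    ∃ L : ℝ → ℂ, ContinuousOn L (Icc p q) ∧ ∀ t ∈ Icc p q, exp (L t) = f t := by
  obtain ⟨F, hF, hF2⟩ := lift_rect (H := fun s _ => f s) h (le_refl (0:ℝ))
    (hc.comp continuous_fst.continuousOn (fun z hz => hz.1)) (fun s hs _ _ => hz s hs)
  exact ⟨fun s => F s 0, Continuous.continuousOn (hF.comp (by fun_prop : Continuous fun s : ℝ => (s, (0:ℝ)))),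
    fun t ht => hF2 t ht 0 ⟨le_rfl, le_rfl⟩⟩

open Classical in
/-- angular variation -/
noncomputable def av (f : ℝ → ℂ) (p q : ℝ) : ℝ :=
  if h : ∃ L : ℝ → ℂ, ContinuousOn L (Icc p q) ∧ ∀ t ∈ Icc p q, exp (L t) = f t then
    (h.choose q - h.choose p).im else 0

theorem av_eq {f L : ℝ → ℂ} {p q : ℝ} (hpq : p ≤ q) (hL : ContinuousOn L (Icc p q))
    (h : ∀ t ∈ Icc p q, exp (L t) = f t) : av f p q = (L q - L p).im := by
  have hex : ∃ L : ℝ → ℂ, ContinuousOn L (Icc p q) ∧ ∀ t ∈ Icc p q, exp (L t) = f t := ⟨L, hL, h⟩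
  rw [av, dif_pos hex, const_diff hpq hex.choose_spec.1 hL]
  intro t ht
  rw [hex.choose_spec.2 t ht, h t ht]

theorem av_add {f : ℝ → ℂ} {p q r : ℝ} (hpq : p ≤ q) (hqr : q ≤ r)
    (hc : ContinuousOn f (Icc p r)) (hz : ∀ t ∈ Icc p r, f t ≠ 0) :
    av f p r = av f p q + av f q r := by
  obtain ⟨L, hL, h⟩ := lift_line (hpq.trans hqr) hc hz
  have h1 : Icc p q ⊆ Icc p r := Icc_subset_Icc_right hqr
  have h2 : Icc q r ⊆ Icc p r := Icc_subset_Icc_left hpq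
  rw [av_eq (hpq.trans hqr) hL h, av_eq hpq (hL.mono h1) (fun t ht => h t (h1 ht)),
    av_eq hqr (hL.mono h2) (fun t ht => h t (h2 ht))]
  simp

theorem av_congr {f g : ℝ → ℂ} {p q : ℝ} (hpq : p ≤ q)
    (hc : ContinuousOn f (Icc p q)) (hz : ∀ t ∈ Icc p q, f t ≠ 0)
    (h : ∀ t ∈ Icc p q, f t = g t) : av f p q = av g p q := by
  obtain ⟨L, hL, hl⟩ := lift_line hpq hc hz
  rw [av_eq hpq hL hl, av_eq hpq hL (fun t ht => (hl t ht).trans (h t ht))]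

theorem av_mul {f g : ℝ → ℂ} {p q : ℝ} (hpq : p ≤ q) {c : ℂ} (hc0 : c ≠ 0)
    (hc : ContinuousOn f (Icc p q)) (hz : ∀ t ∈ Icc p q, f t ≠ 0)
    (h : ∀ t ∈ Icc p q, g t = c * f t) : av g p q = av f p q := by
  obtain ⟨L, hL, hl⟩ := lift_line hpq hc hz
  rw [av_eq hpq hL hl, av_eq (L := fun t => Complex.log c + L t) hpq
    (continuousOn_const.add hL) (fun t ht => ?_)]
  · simp
  · rw [h t ht, Complex.exp_add, Complex.exp_log hc0, hl t ht]

theorem av_neg {f g : ℝ → ℂ} {p q : ℝ} (hpq : p ≤ q) 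
    (hc : ContinuousOn f (Icc p q)) (hz : ∀ t ∈ Icc p q, f t ≠ 0)
    (h : ∀ t ∈ Icc p q, g t = - f t) : av g p q = av f p q :=
  av_mul (c := -1) hpq (by norm_num) hc hz (fun t ht => by rw [h t ht]; ring)

theorem av_rev {f g : ℝ → ℂ} 
    (hc : ContinuousOn f (Icc 0 1)) (hz : ∀ t ∈ Icc (0:ℝ) 1, f t ≠ 0)
    (h : ∀ t, g t = f (1 - t)) : av g 0 1 = - av f 0 1 := by
  obtain ⟨L, hL, hl⟩ := lift_line zero_le_one hc hz
  have hm : ∀ t ∈ Icc (0:ℝ) 1, 1 - t ∈ Icc (0:ℝ) 1 := fun t ht => by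
    constructor <;> linarith [ht.1, ht.2]
  rw [av_eq zero_le_one hL hl, av_eq (L := fun t => L (1 - t)) zero_le_one
    (hL.comp (by fun_prop) hm) (fun t ht => ?_)]
  · simp
  · rw [h, hl _ (hm t ht)]

theorem av_square {H : ℝ → ℝ → ℂ} {p q p' q' : ℝ} (h : p ≤ q) (h' : p' ≤ q')
    (hc : ContinuousOn (Function.uncurry H) (Icc p q ×ˢ Icc p' q'))
    (hz : ∀ s ∈ Icc p q, ∀ t ∈ Icc p' q', H s t ≠ 0) :
    av (fun s => H s p') p q + av (fun t => H q t) p' q' =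
    av (fun s => H s q') p q + av (fun t => H p t) p' q' := by
  obtain ⟨F, hF, hf⟩ := lift_rect h h' hc hz
  have c1 : ∀ t, Continuous fun s => F s t := fun t =>
    hF.comp (by fun_prop : Continuous fun s : ℝ => (s, t))
  have c2 : ∀ s, Continuous fun t => F s t := fun s =>
    hF.comp (by fun_prop : Continuous fun t : ℝ => (s, t))
  have lp := left_mem_Icc.2 h
  have rp := right_mem_Icc.2 h
  have lp' := left_mem_Icc.2 h'
  have rp' := right_mem_Icc.2 h'
  rw [av_eq h (c1 p').continuousOn (fun s hs => hf s hs _ lp'),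
    av_eq h (c1 q').continuousOn (fun s hs => hf s hs _ rp'),
    av_eq h' (c2 p).continuousOn (fun t ht => hf _ lp _ ht),
    av_eq h' (c2 q).continuousOn (fun t ht => hf _ rp _ ht)]
  simp

theorem av_slit {f : ℝ → ℂ} {p q : ℝ} (hpq : p ≤ q) {c : ℂ} (hc0 : c ≠ 0)
    (hc : ContinuousOn f (Icc p q)) (hz : ∀ t ∈ Icc p q, f t / c ∈ slitPlane) :
    av f p q = arg (f q / c) - arg (f p / c) := by
  have h1 : av f p q = av (fun t => f t / c) p q := by
    refine av_mul hpq hc0 (hc.div_const c) (fun t ht => slitPlane_ne_zero (hz t ht)) ?_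
    intro t ht
    field_simp
  rw [h1, av_eq (L := fun t => Complex.log (f t / c)) hpq ((hc.div_const c).clog hz)
    (fun t ht => Complex.exp_log (slitPlane_ne_zero (hz t ht)))]
  simp [Complex.log_im]

theorem av_arg {f : ℝ → ℂ} {p q : ℝ} (hpq : p ≤ q) 
    (hc : ContinuousOn f (Icc p q)) (hz : ∀ t ∈ Icc p q, f t ≠ 0) :
    ∃ k : ℤ, av f p q = arg (f q) - arg (f p) + 2 * Real.pi * k := by
  obtain ⟨L, hL, hl⟩ := lift_line hpq hc hz
  have key : ∀ t ∈ Icc p q, ∃ k : ℤ, (L t).im = arg (f t) + 2 * Real.pi * k := by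
    intro t ht
    have : exp (L t) = exp (Complex.log (f t)) := by
      rw [hl t ht, Complex.exp_log (hz t ht)]
    obtain ⟨k, hk⟩ := Complex.exp_eq_exp_iff_exists_int.1 this
    refine ⟨k, ?_⟩
    rw [hk]
    simp [Complex.log_im]
    ring
  obtain ⟨k1, h1⟩ := key p (left_mem_Icc.2 hpq)
  obtain ⟨k2, h2⟩ := key q (right_mem_Icc.2 hpq)
  refine ⟨k2 - k1, ?_⟩
  rw [av_eq hpq hL hl, sub_im, h1, h2]
  push_cast
  ring

end Topo


namespace Topo
open Complex Set

/-- two disjoint arcs -/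
theorem arcs_disjoint {γ δ : ℝ → ℂ} (hγ : ContinuousOn γ (Icc 0 1)) (hδ : ContinuousOn δ (Icc 0 1))
    (h : ∀ s ∈ Icc (0:ℝ) 1, ∀ t ∈ Icc (0:ℝ) 1, γ s ≠ δ t) :
    av (fun s => γ s - δ 0) 0 1 - av (fun s => γ s - δ 1) 0 1
      + av (fun t => δ t - γ 1) 0 1 - av (fun t => δ t - γ 0) 0 1 = 0 := by
  have hc : ContinuousOn (Function.uncurry fun s t => γ s - δ t) (Icc 0 1 ×ˢ Icc 0 1) :=
    (hγ.comp continuous_fst.continuousOn (fun z hz => hz.1)).sub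
      (hδ.comp continuous_snd.continuousOn (fun z hz => hz.2))
  have := av_square (H := fun s t => γ s - δ t) zero_le_one zero_le_one hc
    (fun s hs t ht => sub_ne_zero.2 (h s hs t ht))
  have h1 : ∀ s ∈ Icc (0:ℝ) 1, av (fun t => δ t - γ s) 0 1 = av (fun t => γ s - δ t) 0 1 := by
    intro s hs
    refine av_neg zero_le_one (continuousOn_const.sub hδ) (fun t ht => sub_ne_zero.2 (h s hs t ht)) ?_
    intro t ht; ring
  rw [h1 1 ⟨zero_le_one, le_rfl⟩, h1 0 ⟨le_rfl, zero_le_one⟩]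
  linarith

/-- first hitting time of a circle -/
theorem first_hit {γ : ℝ → ℂ} (hγ : ContinuousOn γ (Icc 0 1)) {r : ℝ} (hr : 0 < r)
    (h1 : r < ‖γ 1 - γ 0‖) : ∃ s ∈ Icc (0:ℝ) 1, 0 < s ∧ ‖γ s - γ 0‖ = r ∧
      ∀ t ∈ Icc 0 s, ‖γ t - γ 0‖ ≤ r := by
  have hn : ContinuousOn (fun t => ‖γ t - γ 0‖) (Icc 0 1) := (hγ.sub continuousOn_const).norm
  let S : Set ℝ := Icc (0:ℝ) 1 ∩ (fun t => ‖γ t - γ 0‖) ⁻¹' {r}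
  have hS : IsCompact S := by
    have : IsClosed S := hn.preimage_isClosed_of_isClosed isClosed_Icc isClosed_singleton
    exact isCompact_Icc.of_isClosed_subset this inter_subset_left
  have hSn : S.Nonempty := by
    have := intermediate_value_Icc zero_le_one hn
    obtain ⟨t, ht, h⟩ := this ⟨by simpa using hr.le, h1.le⟩
    exact ⟨t, ht, h⟩
  obtain ⟨s, hs, hmin⟩ := hS.exists_isLeast hSn
  refine ⟨s, hs.1, ?_, hs.2, ?_⟩
  · rcases hs.1.1.eq_or_lt with h | h
    · have := hs.2
      simp only [← h, mem_preimage, sub_self, norm_zero, mem_singleton_iff] at this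
      exact absurd this hr.ne
    · exact h
  · intro t ht
    by_contra hlt
    push Not at hlt
    have h2 : Icc 0 t ⊆ Icc (0:ℝ) 1 := Icc_subset_Icc_right (ht.2.trans hs.1.2)
    obtain ⟨t', ht', h⟩ := intermediate_value_Icc ht.1 (hn.mono h2) ⟨by simpa using hr.le, hlt.le⟩
    have := hmin ⟨h2 ht', h⟩
    have h3 : t' = t := by linarith [ht'.2, ht.2]
    simp only [h3] at h
    linarith

structure TwoArcs (γ δ : ℝ → ℂ) : Prop where
  c1 : ContinuousOn γ (Icc 0 1)
  c2 : ContinuousOn δ (Icc 0 1)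
  start : γ 0 = δ 0
  meet : ∀ s ∈ Icc (0:ℝ) 1, ∀ t ∈ Icc (0:ℝ) 1, γ s = δ t → s = 0 ∧ t = 0

theorem TwoArcs.symm {γ δ : ℝ → ℂ} (h : TwoArcs γ δ) : TwoArcs δ γ :=
  ⟨h.c2, h.c1, h.start.symm, fun s hs t ht e => (h.meet t ht s hs e.symm).symm⟩

theorem two_arcs_trunc {γ δ : ℝ → ℂ} (h : TwoArcs γ δ) 
    (hi : ∀ s ∈ Icc (0:ℝ) 1, γ s = γ 0 → s = 0) (hj : ∀ s ∈ Icc (0:ℝ) 1, δ s = δ 0 → s = 0)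
    {s t : ℝ} (hs : s ∈ Icc (0:ℝ) 1) (ht : t ∈ Icc (0:ℝ) 1) (s0 : 0 < s) (t0 : 0 < t) :
    av (fun u => γ u - δ 1) 0 1 - av (fun u => δ u - γ 1) 0 1 =
    av (fun u => γ u - δ t) 0 s - av (fun u => δ u - γ s) 0 t
     + av (fun u => γ u - γ 0) s 1 - av (fun u => δ u - γ 0) t 1 := by
  have cγ : ∀ {w : ℂ} {p q : ℝ}, 0 ≤ p → q ≤ 1 → ContinuousOn (fun u => γ u - w) (Icc p q) := by
    intro w p q h1 h2; exact (h.c1.mono (Icc_subset_Icc h1 h2)).sub continuousOn_const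
  have cδ : ∀ {w : ℂ} {p q : ℝ}, 0 ≤ p → q ≤ 1 → ContinuousOn (fun u => δ u - w) (Icc p q) := by
    intro w p q h1 h2; exact (h.c2.mono (Icc_subset_Icc h1 h2)).sub continuousOn_const
  have hH : ContinuousOn (Function.uncurry fun s t => γ s - δ t) (Icc 0 1 ×ˢ Icc 0 1) :=
    (h.c1.comp continuous_fst.continuousOn (fun z hz => hz.1)).sub
      (h.c2.comp continuous_snd.continuousOn (fun z hz => hz.2))
  have flip : ∀ {s' p q : ℝ}, s' ∈ Icc (0:ℝ) 1 → 0 ≤ p → p ≤ q → q ≤ 1 → (0 < s' ∨ 0 < p) → 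
      av (fun t => γ s' - δ t) p q = av (fun t => δ t - γ s') p q := by
    intro s' p q hs' h0 h1 h2 h3
    refine av_neg h1 (cδ h0 h2) (fun t ht => sub_ne_zero.2 fun e => ?_) (fun t ht => by ring)
    have := h.meet s' hs' t ⟨h0.trans ht.1, ht.2.trans h2⟩ e.symm
    rcases h3 with h3 | h3 <;> linarith [ht.1]
  have r1 := av_square (H := fun s t => γ s - δ t) hs.2 zero_le_one
    (hH.mono (prod_mono (Icc_subset_Icc_left hs.1) le_rfl))
    (fun u hu v hv => sub_ne_zero.2 fun e => by
      have := h.meet u ⟨hs.1.trans hu.1, hu.2⟩ v hv e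
      linarith [hu.1])
  have r2 := av_square (H := fun s t => γ s - δ t) hs.1 ht.2
    (hH.mono (prod_mono (Icc_subset_Icc_right hs.2) (Icc_subset_Icc_left ht.1)))
    (fun u hu v hv => sub_ne_zero.2 fun e => by
      have := h.meet u ⟨hu.1, hu.2.trans hs.2⟩ v ⟨ht.1.trans hv.1, hv.2⟩ e
      linarith [hv.1])
  have z1 : (0:ℝ) ∈ Icc (0:ℝ) 1 := ⟨le_rfl, zero_le_one⟩
  have o1 : (1:ℝ) ∈ Icc (0:ℝ) 1 := ⟨zero_le_one, le_rfl⟩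
  rw [flip o1 le_rfl zero_le_one le_rfl (Or.inl one_pos), flip hs le_rfl zero_le_one le_rfl (Or.inl s0),
    ← h.start] at r1
  rw [flip hs ht.1 ht.2 le_rfl (Or.inl s0), flip z1 ht.1 ht.2 le_rfl (Or.inr t0)] at r2
  have a1 := av_add (f := fun u => γ u - δ 1) hs.1 hs.2 (cγ le_rfl le_rfl)
    (fun u hu => sub_ne_zero.2 fun e => by
      have := h.meet u hu 1 o1 e
      linarith)
  have a2 := av_add (f := fun u => δ u - γ s) ht.1 ht.2 (cδ le_rfl le_rfl)
    (fun u hu => sub_ne_zero.2 fun e => by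
      have := h.meet s hs u hu e.symm
      linarith)
  linarith

theorem arg_sum {u v w : ℂ} (hu : ‖u‖ = 1) (hv : ‖v‖ = 1) (hw : ‖w‖ = 1) (h : u * v * w = 1)
    (u1 : u ≠ 1) (v1 : v ≠ 1) (w1 : w ≠ 1) :
    arg (1 - u) + arg (1 - v) + arg (1 - w) = Real.pi / 2 ∨
    arg (1 - u) + arg (1 - v) + arg (1 - w) = -(Real.pi / 2) := by
  have re_pos : ∀ {z : ℂ}, ‖z‖ = 1 → z ≠ 1 → 0 < (1 - z).re := by
    intro z hz hz1
    have h1 : z.re ≤ ‖z‖ := (le_abs_self _).trans (abs_re_le_norm z)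
    rcases h1.eq_or_lt with h2 | h2
    · exfalso
      apply hz1
      rw [hz] at h2
      have h3 := Complex.sq_norm z
      rw [hz, normSq_apply, h2] at h3
      have : z.im = 0 := by nlinarith
      apply Complex.ext <;> simp [h2, this]
    · simp; linarith
  have bd : ∀ {z : ℂ}, ‖z‖ = 1 → z ≠ 1 → |arg (1 - z)| < Real.pi / 2 := by
    intro z hz hz1
    rw [Complex.abs_arg_lt_pi_div_two_iff]
    exact Or.inl (re_pos hz hz1)
  have bu := abs_lt.1 (bd hu u1)
  have bv := abs_lt.1 (bd hv v1)
  have bw := abs_lt.1 (bd hw w1)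
  have cj : ∀ {z : ℂ}, ‖z‖ = 1 → (starRingEnd ℂ) z * z = 1 := by
    intro z hz
    rw [mul_comm, Complex.mul_conj, normSq_eq_norm_sq, hz]; simp
  set S := arg (1 - u) + arg (1 - v) + arg (1 - w) with hS
  have hP : (1 - u) * (1 - v) * (1 - w) =
      ((‖1 - u‖ * ‖1 - v‖ * ‖1 - w‖ : ℝ) : ℂ) * exp (S * I) := by
    conv_lhs => rw [← Complex.norm_mul_exp_arg_mul_I (1 - u), ← Complex.norm_mul_exp_arg_mul_I (1 - v),
      ← Complex.norm_mul_exp_arg_mul_I (1 - w)]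
    have : exp (S * I) = exp (arg (1 - u) * I) * exp (arg (1 - v) * I) * exp (arg (1 - w) * I) := by
      rw [← Complex.exp_add, ← Complex.exp_add, hS]; push_cast; congr 1; ring
    rw [this]; push_cast; ring
  have hre : ((1 - u) * (1 - v) * (1 - w)).re = 0 := by
    have h1 : (starRingEnd ℂ) ((1 - u) * (1 - v) * (1 - w)) = -((1 - u) * (1 - v) * (1 - w)) := by
      have e : (starRingEnd ℂ) ((1 - u) * (1 - v) * (1 - w)) * (u * v * w) =
        -((1 - u) * (1 - v) * (1 - w)) := by
        simp only [map_mul, map_sub, map_one]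
        have a := cj hu; have b := cj hv; have c := cj hw
        calc _ = (u - (starRingEnd ℂ) u * u) * (v - (starRingEnd ℂ) v * v) * (w - (starRingEnd ℂ) w * w) := by ring
          _ = _ := by rw [a, b, c]; ring
      rwa [h, mul_one] at e
    have := congrArg Complex.re h1
    rw [conj_re, neg_re] at this
    linarith
  rw [hP, re_ofReal_mul, Complex.exp_ofReal_mul_I_re] at hre
  have n1 : ∀ {z : ℂ}, z ≠ 1 → ‖1 - z‖ ≠ 0 := fun hz => norm_ne_zero_iff.2 (sub_ne_zero.2 hz.symm)
  have hcos : Real.cos S = 0 := by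
    rcases mul_eq_zero.1 hre with h | h
    · exact absurd h (mul_ne_zero (mul_ne_zero (n1 u1) (n1 v1)) (n1 w1))
    · exact h
  obtain ⟨k, hk⟩ := Real.cos_eq_zero_iff.1 hcos
  have hpi := Real.pi_pos
  have k1 : (k : ℝ) < 1 := by
    by_contra hh; push Not at hh
    nlinarith
  have k2 : (-2 : ℝ) < k := by
    by_contra hh; push Not at hh
    nlinarith
  have k1' : k < 1 := by exact_mod_cast k1
  have k2' : -2 < k := by exact_mod_cast k2
  have : k = 0 ∨ k = -1 := by omega
  rcases this with rfl | rfl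
  · left; rw [hk]; simp
  · right; rw [hk]; push_cast; ring

theorem trunc_arg {γ : ℝ → ℂ} {s r : ℝ} {b : ℂ} (s0 : 0 ≤ s) (hr : 0 < r) (hc : ContinuousOn γ (Icc 0 s))
    (hb : ‖b - γ 0‖ = r) (hn : ∀ t ∈ Icc 0 s, ‖γ t - γ 0‖ ≤ r) (hne : ∀ t ∈ Icc 0 s, γ t ≠ b) :
    av (fun t => γ t - b) 0 s = arg (1 - (γ s - γ 0) / (b - γ 0)) := by
  have hb0 : b - γ 0 ≠ 0 := by
    intro h; rw [h, norm_zero] at hb; linarith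
  have hc0 : γ 0 - b ≠ 0 := by
    intro h; apply hb0; linear_combination -h
  have key : ∀ t, (γ t - b) / (γ 0 - b) = 1 - (γ t - γ 0) / (b - γ 0) := by
    intro t
    field_simp
    ring
  rw [av_slit (f := fun t => γ t - b) s0 hc0 (hc.sub continuousOn_const)]
  · rw [key, key]; simp
  · intro t ht
    rw [key]
    left
    set z := (γ t - γ 0) / (b - γ 0) with hz
    have hz1 : ‖z‖ ≤ 1 := by
      rw [hz, norm_div, hb, div_le_one hr]; exact hn t ht
    have hzn : z ≠ 1 := by
      intro h
      rw [hz, div_eq_one_iff_eq hb0] at h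
      exact hne t ht (by linear_combination h)
    have h1 : z.re ≤ ‖z‖ := (le_abs_self _).trans (abs_re_le_norm z)
    simp only [sub_re, one_re, sub_pos]
    by_contra hh
    push Not at hh
    have h2 : z.re = 1 := by linarith
    have h3 := Complex.sq_norm z
    rw [normSq_apply, h2] at h3
    have : z.im = 0 := by nlinarith [norm_nonneg z]
    apply hzn
    apply Complex.ext <;> simp [h2, this]

theorem three_arcs {γ δ ε : ℝ → ℂ} (h12 : TwoArcs γ δ) (h23 : TwoArcs δ ε) (h31 : TwoArcs ε γ)
    (i1 : ∀ s ∈ Icc (0:ℝ) 1, γ s = γ 0 → s = 0) (i2 : ∀ s ∈ Icc (0:ℝ) 1, δ s = δ 0 → s = 0)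
    (i3 : ∀ s ∈ Icc (0:ℝ) 1, ε s = ε 0 → s = 0) :
    (av (fun u => γ u - δ 1) 0 1 - av (fun u => δ u - γ 1) 0 1) +
    (av (fun u => δ u - ε 1) 0 1 - av (fun u => ε u - δ 1) 0 1) +
    (av (fun u => ε u - γ 1) 0 1 - av (fun u => γ u - ε 1) 0 1) = Real.pi ∨
    (av (fun u => γ u - δ 1) 0 1 - av (fun u => δ u - γ 1) 0 1) +
    (av (fun u => δ u - ε 1) 0 1 - av (fun u => ε u - δ 1) 0 1) +
    (av (fun u => ε u - γ 1) 0 1 - av (fun u => γ u - ε 1) 0 1) = - Real.pi := by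
  have o1 : (1:ℝ) ∈ Icc (0:ℝ) 1 := ⟨zero_le_one, le_rfl⟩
  have p1 : 0 < ‖γ 1 - γ 0‖ := norm_pos_iff.2 (sub_ne_zero.2 fun h => one_ne_zero (i1 1 o1 h))
  have p2 : 0 < ‖δ 1 - δ 0‖ := norm_pos_iff.2 (sub_ne_zero.2 fun h => one_ne_zero (i2 1 o1 h))
  have p3 : 0 < ‖ε 1 - ε 0‖ := norm_pos_iff.2 (sub_ne_zero.2 fun h => one_ne_zero (i3 1 o1 h))
  obtain ⟨r, hr, hr1, hr2, hr3⟩ : ∃ r : ℝ, 0 < r ∧ r < ‖γ 1 - γ 0‖ ∧ r < ‖δ 1 - δ 0‖ ∧ r < ‖ε 1 - ε 0‖ := by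
    obtain ⟨r, hr, h⟩ := exists_between (lt_min p1 (lt_min p2 p3))
    rw [lt_min_iff, lt_min_iff] at h
    exact ⟨r, hr, h.1, h.2.1, h.2.2⟩
  obtain ⟨s1, m1, q1, e1, l1⟩ := first_hit h12.c1 hr hr1
  obtain ⟨s2, m2, q2, e2, l2⟩ := first_hit h23.c1 hr hr2
  obtain ⟨s3, m3, q3, e3, l3⟩ := first_hit h31.c1 hr hr3
  have t12 := two_arcs_trunc h12 i1 i2 m1 m2 q1 q2
  have t23 := two_arcs_trunc h23 i2 i3 m2 m3 q2 q3
  have t31 := two_arcs_trunc h31 i3 i1 m3 m1 q3 q1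
  have ta : ∀ {γ δ : ℝ → ℂ} {s t : ℝ}, TwoArcs γ δ → s ∈ Icc (0:ℝ) 1 → t ∈ Icc (0:ℝ) 1 → 0 < s → 0 < t → 
    ‖δ t - δ 0‖ = r → (∀ u ∈ Icc 0 s, ‖γ u - γ 0‖ ≤ r) → 
     av (fun u => γ u - δ t) 0 s = arg (1 - (γ s - γ 0) / (δ t - γ 0)) := by
    intro γ δ s t h hs ht s0 t0 e l
    refine trunc_arg hs.1 hr (h.c1.mono (Icc_subset_Icc_right hs.2)) (by rw [h.start]; exact e) l ?_
    intro u hu he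
    have := h.meet u ⟨hu.1, hu.2.trans hs.2⟩ t ht he
    linarith
  rw [ta h12 m1 m2 q1 q2 e2 l1, ta h12.symm m2 m1 q2 q1 e1 l2] at t12
  rw [ta h23 m2 m3 q2 q3 e3 l2, ta h23.symm m3 m2 q3 q2 e2 l3] at t23
  rw [ta h31 m3 m1 q3 q1 e1 l3, ta h31.symm m1 m3 q1 q3 e3 l1] at t31
  have a1 := h12.start
  have a2 := h23.start
  rw [← a2, ← a1] at t31 t23 e3
  rw [← a1] at t12 e2 
  set u := γ s1 - γ 0 with hu
  set v := δ s2 - γ 0 with hv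
  set w := ε s3 - γ 0 with hw
  have nz : ∀ {z : ℂ}, ‖z‖ = r → z ≠ 0 := by
    intro z hz h; rw [h, norm_zero] at hz; linarith
  have u0 := nz e1
  have v0 := nz e2
  have w0 := nz e3
  have uv : u ≠ v := by
    intro h; have := h12.meet s1 m1 s2 m2 (by linear_combination h); linarith
  have vw : v ≠ w := by
    intro h; have := h23.meet s2 m2 s3 m3 (by linear_combination h); linarith
  have wu : w ≠ u := by
    intro h; have := h31.meet s3 m3 s1 m1 (by linear_combination h); linarith
  have flip : ∀ {z z' : ℂ}, ‖z‖ = r → ‖z'‖ = r → z ≠ z' → arg (1 - z' / z) = - arg (1 - z / z') := by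
    intro z z' hz hz' hne
    have h1 : z' / z = (starRingEnd ℂ) (z / z') := by
      have n : ‖z / z'‖ = 1 := by rw [norm_div, hz, hz', div_self hr.ne']
      have : (z / z') * (starRingEnd ℂ) (z / z') = 1 := by
        rw [Complex.mul_conj, normSq_eq_norm_sq, n]; simp
      have h3 : (z / z') * (z' / z) = 1 := by
        have := nz hz; have := nz hz'; field_simp
      have h4 : z / z' ≠ 0 := div_ne_zero (nz hz) (nz hz')
      exact mul_left_cancel₀ h4 (h3.trans this.symm)
    have h2 : 1 - z' / z = (starRingEnd ℂ) (1 - z / z') := by rw [h1]; simp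
    rw [h2, Complex.arg_conj, if_neg]
    intro hpi
    rw [Complex.arg_eq_pi_iff] at hpi
    have n : ‖z / z'‖ = 1 := by rw [norm_div, hz, hz', div_self hr.ne']
    have := (le_abs_self _).trans (abs_re_le_norm (z / z'))
    have h5 := hpi.1
    rw [sub_re, one_re] at h5
    linarith
  rw [flip e1 e2 uv] at t12
  rw [flip e2 e3 vw] at t23
  rw [flip e3 e1 wu] at t31
  have n : ∀ {z z' : ℂ}, ‖z‖ = r → ‖z'‖ = r → ‖z / z'‖ = 1 := by
    intro z z' hz hz'; rw [norm_div, hz, hz', div_self hr.ne']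
  have := arg_sum (n e1 e2) (n e2 e3) (n e3 e1) (by field_simp)
    (by rwa [Ne, div_eq_one_iff_eq v0]) (by rwa [Ne, div_eq_one_iff_eq w0]) (by rwa [Ne, div_eq_one_iff_eq u0])
  rcases this with h | h
  · left; linarith
  · right; linarith

end Topo


namespace Topo
open Complex Set

theorem arg_neg_sub (z : ℂ) (hz : z ≠ 0) : arg (-z) - arg z = Real.pi ∨ arg (-z) - arg z = -Real.pi := by
  have h1 : ((arg (-z) - arg z : ℝ) : Real.Angle) = (Real.pi : ℝ) := by
    rw [Real.Angle.coe_sub, Complex.arg_neg_coe_angle hz]; abel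
  obtain ⟨k, hk⟩ := Real.Angle.angle_eq_iff_two_pi_dvd_sub.1 h1
  have a1 := Complex.neg_pi_lt_arg z
  have a2 := Complex.arg_le_pi z
  have b1 := Complex.neg_pi_lt_arg (-z)
  have b2 := Complex.arg_le_pi (-z)
  have hpi := Real.pi_pos
  have k1 : (k : ℝ) < 1 := by
    by_contra hh; push Not at hh
    nlinarith
  have k2 : (-2 : ℝ) < k := by
    by_contra hh; push Not at hh
    nlinarith
  have k1' : k < 1 := by exact_mod_cast k1
  have k2' : -2 < k := by exact_mod_cast k2
  have : k = 0 ∨ k = -1 := by omega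
  rcases this with rfl | rfl
  · left; push_cast at hk; linarith
  · right; push_cast at hk; linarith

noncomputable def cx (p : ℝ × ℝ) : ℂ := Complex.equivRealProdCLM.symm p

theorem cx_cont : Continuous cx := Complex.equivRealProdCLM.symm.continuous

theorem cx_inj : Function.Injective cx := Complex.equivRealProdCLM.symm.injective

variable {V : Type*} {G : SimpleGraph V}

/-- angular data of a drawing -/
structure Data (D : Drawing G) where
  h : V → V → ℤ
  k : V → V → V → ℤ
  h_one : ∀ u v, u ≠ v → h u v = 1 ∨ h u v = -1
  h_neg : ∀ u v, h v u = - h u v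
  k_neg : ∀ u v w, G.Adj u v → w ≠ u → w ≠ v → k v u w = - k u v w
  rot : ∀ u v w z, G.Adj u v → G.Adj u w → G.Adj u z → v ≠ w → w ≠ z → z ≠ v →
    (h v w + 2 * k u v w - 2 * k u w v) + (h w z + 2 * k u w z - 2 * k u z w)
      + (h z v + 2 * k u z v - 2 * k u v z) = 1 ∨
    (h v w + 2 * k u v w - 2 * k u w v) + (h w z + 2 * k u w z - 2 * k u z w)
      + (h z v + 2 * k u z v - 2 * k u v z) = -1
  cross : ∀ a b c d, G.Adj a b → G.Adj c d → a ≠ c → a ≠ d → b ≠ c → b ≠ d →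
    h b c - h a c - h b d + h a d + 2 * (k a b c - k a b d + k c d b - k c d a) ≠ 0 →
    ∃ p, D.IsCrossing s(a, b) s(c, d) p

theorem exists_data (D : Drawing G) (hD : D.IsGood) : Nonempty (Data D) := by
  have pi0 := Real.pi_ne_zero
  set P : V → ℂ := fun v => cx (D.pos v) with hP
  have Pinj : Function.Injective P := cx_inj.comp D.pos_inj
  set γ : V → V → ℝ → ℂ := fun u v t => cx (D.arc u v t) with hγ
  have γc : ∀ {u v}, G.Adj u v → ContinuousOn (γ u v) (Icc 0 1) := fun h =>
    cx_cont.comp_continuousOn (D.arc_cont h)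
  have γ0 : ∀ {u v}, G.Adj u v → γ u v 0 = P u := fun h => by simp only [hγ, hP, D.arc_zero h]
  have γ1 : ∀ {u v}, G.Adj u v → γ u v 1 = P v := fun h => by simp only [hγ, hP, D.arc_one h]
  have γa : ∀ {u v w}, G.Adj u v → w ≠ u → w ≠ v → ∀ t ∈ Icc (0:ℝ) 1, γ u v t - P w ≠ 0 := by
    intro u v w h h1 h2 t ht e
    exact D.arc_avoid h w h1 h2 ⟨t, ht, cx_inj (sub_eq_zero.1 e)⟩
  have avP : ∀ {u v w}, G.Adj u v → ContinuousOn (fun t => γ u v t - P w) (Icc 0 1) := fun h =>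
    (γc h).sub continuousOn_const
  set θ : V → V → ℝ := fun u v => arg (P v - P u) with hθ
  have hh : ∀ u v, ∃ m : ℤ, θ v u - θ u v = Real.pi * m ∧ (u ≠ v → m = 1 ∨ m = -1) := by
    intro u v
    by_cases huv : u = v
    · exact ⟨0, by simp [huv], fun h => absurd huv h⟩
    · have : P v - P u ≠ 0 := sub_ne_zero.2 fun e => huv (Pinj e).symm
      have := arg_neg_sub _ this
      rw [neg_sub] at this
      rcases this with h | h
      · exact ⟨1, by simpa [hθ] using h, fun _ => Or.inl rfl⟩
      · exact ⟨-1, by simpa [hθ] using h, fun _ => Or.inr rfl⟩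
  choose h hh1 hh2 using hh
  have hk : ∀ u v w, ∃ m : ℤ, G.Adj u v → w ≠ u → w ≠ v →
      av (fun t => γ u v t - P w) 0 1 = θ w v - θ w u + 2 * Real.pi * m := by
    intro u v w
    by_cases hc : G.Adj u v ∧ w ≠ u ∧ w ≠ v
    · obtain ⟨m, hm⟩ := av_arg zero_le_one (avP (w := w) hc.1) (γa hc.1 hc.2.1 hc.2.2)
      refine ⟨m, fun _ _ _ => ?_⟩
      rw [hm, γ0 hc.1, γ1 hc.1]
    · exact ⟨0, fun a b c => absurd ⟨a, b, c⟩ hc⟩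
  choose k hk using hk
  refine ⟨⟨h, k, hh2, ?_, ?_, ?_, ?_⟩⟩
  · intro u v
    have := hh1 u v
    have h2 := hh1 v u
    have h3 : Real.pi * ((h v u : ℝ) + h u v) = 0 := by linarith
    have h4 := (mul_eq_zero.1 h3).resolve_left pi0
    have h5 : h v u + h u v = 0 := by exact_mod_cast h4
    omega
  · intro u v w huv h1 h2
    have e1 := hk u v w huv h1 h2
    have e2 := hk v u w huv.symm h2 h1
    have e3 := av_rev (g := fun t => γ v u t - P w) (avP (w := w) huv) (γa huv h1 h2) (fun t => by
      simp only [hγ, D.arc_symm huv t])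
    have h3 : 2 * Real.pi * ((k v u w : ℝ) + k u v w) = 0 := by linarith
    have h4 := (mul_eq_zero.1 h3).resolve_left (by simpa using pi0)
    have h5 : k v u w + k u v w = 0 := by exact_mod_cast h4
    omega
  · have two : ∀ {u v w}, G.Adj u v → G.Adj u w → v ≠ w → TwoArcs (γ u v) (γ u w) := by
      intro u v w huv huw hvw
      refine ⟨γc huv, γc huw, by rw [γ0 huv, γ0 huw], ?_⟩
      intro s hs t ht e
      have e' : D.arc u v s = D.arc u w t := cx_inj e
      have hu : D.arc u v s = D.pos u := by
        by_contra hne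
        refine hD.adj_no_cross s(u, v) s(u, w) ⟨u, by simp, by simp⟩ (D.arc u v s)
          ⟨huv, huw, ?_, ⟨u, v, rfl, huv, s, hs, rfl⟩, ⟨u, w, rfl, huw, t, ht, e'.symm⟩, ?_, ?_⟩
        · intro h
          simp only [Sym2.eq_iff, true_and] at h
          rcases h with h | h
          · exact hvw h
          · exact hvw (h.2.trans h.1)
        · rintro ⟨a, ha, h⟩
          rcases Sym2.mem_iff.1 ha with rfl | rfl
          · exact hne h
          · exact D.arc_avoid huw a huv.ne' hvw ⟨t, ht, by rw [← e', h]⟩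
        · rintro ⟨a, ha, h⟩
          rcases Sym2.mem_iff.1 ha with rfl | rfl
          · exact hne h
          · exact D.arc_avoid huv a huw.ne' hvw.symm ⟨s, hs, h⟩
      have z0 : (0:ℝ) ∈ Icc (0:ℝ) 1 := ⟨le_rfl, zero_le_one⟩
      exact ⟨hD.arc_inj huv hs z0 (by rw [hu, D.arc_zero huv]),
        hD.arc_inj huw ht z0 (by rw [← e', hu, D.arc_zero huw])⟩
    have inj : ∀ {u v}, G.Adj u v → ∀ s ∈ Icc (0:ℝ) 1, γ u v s = γ u v 0 → s = 0 := by
      intro u v huv s hs e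
      exact hD.arc_inj huv hs ⟨le_rfl, zero_le_one⟩ (cx_inj e)
    intro u v w z uv uw uz vw wz zv
    have := three_arcs (two uv uw vw) (two uw uz wz) (two uz uv zv) (inj uv) (inj uw) (inj uz)
    simp only [γ1 uv, γ1 uw, γ1 uz] at this
    rw [hk u v w uv uw.ne' vw.symm, hk u w v uw uv.ne' vw, hk u w z uw uz.ne' wz.symm,
      hk u z w uz uw.ne' wz, hk u z v uz uv.ne' zv.symm, hk u v z uv uz.ne' zv] at this
    have e1 := hh1 v w
    have e2 := hh1 w z
    have e3 := hh1 z v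
    rcases this with h' | h'
    · left
      have : Real.pi * (((h v w + 2 * k u v w - 2 * k u w v) + (h w z + 2 * k u w z - 2 * k u z w)
        + (h z v + 2 * k u z v - 2 * k u v z) : ℤ) - 1 : ℝ) = 0 := by push_cast; linarith
      have := (mul_eq_zero.1 this).resolve_left pi0
      rw [sub_eq_zero] at this
      exact_mod_cast this
    · right
      have : Real.pi * (((h v w + 2 * k u v w - 2 * k u w v) + (h w z + 2 * k u w z - 2 * k u z w)
        + (h z v + 2 * k u z v - 2 * k u v z) : ℤ) - (-1) : ℝ) = 0 := by push_cast; linarith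
      have := (mul_eq_zero.1 this).resolve_left pi0
      rw [sub_eq_zero] at this
      exact_mod_cast this
  · intro a b c d ab cd hac had hbc hbd hne
    by_contra hno
    push Not at hno
    apply hne
    have hdis : ∀ s ∈ Icc (0:ℝ) 1, ∀ t ∈ Icc (0:ℝ) 1, γ a b s ≠ γ c d t := by
      intro s hs t ht e
      have e' : D.arc a b s = D.arc c d t := cx_inj e
      apply hno (D.arc a b s)
      refine ⟨ab, cd, ?_, ⟨a, b, rfl, ab, s, hs, rfl⟩, ⟨c, d, rfl, cd, t, ht, e'.symm⟩, ?_, ?_⟩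
      · intro h
        simp only [Sym2.eq_iff] at h
        rcases h with h | h
        · exact hac h.1
        · exact had h.1
      · rintro ⟨x, hx, h⟩
        rcases Sym2.mem_iff.1 hx with rfl | rfl
        · exact D.arc_avoid cd x hac had ⟨t, ht, by rw [← e', h]⟩
        · exact D.arc_avoid cd x hbc hbd ⟨t, ht, by rw [← e', h]⟩
      · rintro ⟨x, hx, h⟩
        rcases Sym2.mem_iff.1 hx with rfl | rfl
        · exact D.arc_avoid ab x hac.symm hbc.symm ⟨s, hs, h⟩
        · exact D.arc_avoid ab x had.symm hbd.symm ⟨s, hs, h⟩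
    have := arcs_disjoint (γc ab) (γc cd) hdis
    rw [γ0 ab, γ1 ab, γ0 cd, γ1 cd, hk a b c ab hac.symm hbc.symm, hk a b d ab had.symm hbd.symm,
      hk c d b cd hbc hbd, hk c d a cd hac had] at this
    have e1 := hh1 b c
    have e2 := hh1 a c
    have e3 := hh1 b d
    have e4 := hh1 a d
    have h1 : Real.pi * ((h b c - h a c - h b d + h a d + 2 * (k a b c - k a b d + k c d b - k c d a) : ℤ) : ℝ) = 0 := by
      push_cast; linarith
    have := (mul_eq_zero.1 h1).resolve_left pi0
    exact_mod_cast this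

end Topo


namespace Comb
open Finset

variable {C : Type*} [DecidableEq C]

/-- twice the number of crossings -/
def f2 (c : C → C → ℤ) (S : Finset C) : ℤ := ∑ x ∈ S, ∑ y ∈ S, c x y

structure Good (c : C → C → ℤ) : Prop where
  nonneg : ∀ x y, 0 ≤ c x y
  symm : ∀ x y, c x y = c y x
  diag : ∀ x, c x x = 0
  parity : ∃ e : C → ℤ, ∀ x y, x ≠ y → ∃ q, c x y = e x + e y + 2 * q
  triple : ∀ x y z, x ≠ y → y ≠ z → x ≠ z → 4 ≤ c x y + c y z + c x z
  x5 : ∀ (v w : C) (x : Fin 3 → C), Function.Injective x → (∀ i, x i ≠ v) → (∀ i, x i ≠ w) →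
    v ≠ w → c v w = 2 → (∀ i, c v (x i) = 1) → (∀ i, c w (x i) = 1) →
    (∀ i j, i ≠ j → c (x i) (x j) = 2) → False
  x7 : ∀ (v : C) (x : Fin 5 → C), Function.Injective x → (∀ i, x i ≠ v) →
    (∀ i, c v (x i) = 1) → (∀ i j, i ≠ j → c (x i) (x j) = 2) → False

variable {c : C → C → ℤ}

theorem f2_insert (h : Good c) {S : Finset C} {x : C} (hx : x ∉ S) :
    f2 c (insert x S) = f2 c S + 2 * ∑ y ∈ S, c x y := by
  unfold f2
  simp only [sum_insert hx, h.diag, sum_add_distrib, zero_add]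
  rw [sum_congr rfl (fun y _ => h.symm y x)]
  ring

theorem f2_erase (h : Good c) {S : Finset C} {x : C} (hx : x ∈ S) :
    f2 c S = f2 c (S.erase x) + 2 * ∑ y ∈ S, c x y := by
  conv_lhs => rw [← insert_erase hx]
  rw [f2_insert h (notMem_erase x S)]
  congr 2
  rw [← add_sum_erase S _ hx, h.diag, zero_add]

theorem f2_parity (h : Good c) {e : C → ℤ} (he : ∀ x y, x ≠ y → ∃ q, c x y = e x + e y + 2 * q)
    (S : Finset C) : ∃ q, f2 c S = 2 * ((S.card : ℤ) - 1) * ∑ x ∈ S, e x + 4 * q := by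
  induction S using Finset.induction_on with
  | empty => exact ⟨0, by simp [f2]⟩
  | insert x S hx ih =>
    obtain ⟨q, hq⟩ := ih
    have : ∃ r, ∑ y ∈ S, c x y = S.card * e x + ∑ y ∈ S, e y + 2 * r := by
      have h1 : ∀ y, ∃ q, x ≠ y → c x y = e x + e y + 2 * q := by
        intro y
        by_cases hxy : x = y
        · exact ⟨0, fun h => absurd hxy h⟩
        · obtain ⟨q, hq⟩ := he x y hxy
          exact ⟨q, fun _ => hq⟩
      choose r hr using h1
      refine ⟨∑ y ∈ S, r y, ?_⟩
      rw [sum_congr rfl (fun y hy => hr y (fun e => hx (e ▸ hy)))]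
      rw [sum_add_distrib, sum_add_distrib, ← mul_sum]
      simp
    obtain ⟨r, hr⟩ := this
    refine ⟨q + r, ?_⟩
    rw [f2_insert h hx, hq, hr, card_insert_of_notMem hx, sum_insert hx]
    push_cast
    ring

/-- the target function, doubled -/
def tgt (n : ℕ) : ℤ := 8 * ((n / 2 : ℕ) : ℤ) * (((n - 1) / 2 : ℕ) : ℤ)

theorem tgt_even (k : ℕ) : tgt (2 * k + 2) = 8 * (k + 1) * k := by
  unfold tgt
  have h1 : (2 * k + 2) / 2 = k + 1 := by omega
  have h2 : (2 * k + 2 - 1) / 2 = k := by omega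
  rw [h1, h2]; push_cast; ring

theorem tgt_odd (k : ℕ) : tgt (2 * k + 1) = 8 * k * k := by
  unfold tgt
  have h1 : (2 * k + 1) / 2 = k := by omega
  have h2 : (2 * k + 1 - 1) / 2 = k := by omega
  rw [h1, h2]

theorem f2_delete_sum (h : Good c) (S : Finset C) :
    ∑ x ∈ S, f2 c (S.erase x) = (S.card - 2) * f2 c S := by
  have : ∀ x ∈ S, f2 c (S.erase x) = f2 c S - 2 * ∑ y ∈ S, c x y := by
    intro x hx
    rw [f2_erase h hx]; ring
  rw [sum_congr rfl this, sum_sub_distrib, ← mul_sum]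
  simp only [sum_const, nsmul_eq_mul]
  rw [show ∑ x ∈ S, ∑ y ∈ S, c x y = f2 c S from rfl]
  ring

theorem zero_pair (h : Good c) {S : Finset C} {k : ℕ} (hS : S.card = 2 * k + 3)
    (ih : ∀ T : Finset C, T.card < S.card → tgt T.card ≤ f2 c T)
    {x y : C} (hx : x ∈ S) (hy : y ∈ S) (hxy : x ≠ y) (h0 : c x y = 0) : tgt S.card ≤ f2 c S := by
  have hy' : y ∈ S.erase x := mem_erase.2 ⟨hxy.symm, hy⟩
  set T := (S.erase x).erase y with hT
  have hTc : T.card = 2 * k + 1 := by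
    rw [hT, card_erase_of_mem hy', card_erase_of_mem hx, hS]; omega
  have e1 := f2_erase h hx
  have e2 := f2_erase h hy'
  have i1 := ih T (by omega)
  have s1 : ∑ z ∈ S, c x z = ∑ z ∈ T, c x z := by
    rw [← add_sum_erase S _ hx, ← add_sum_erase _ _ hy', h.diag, h0]; simp [hT]
  have s2 : ∑ z ∈ S.erase x, c y z = ∑ z ∈ T, c y z := by
    rw [← add_sum_erase _ _ hy', h.diag]; simp [hT]
  have s3 : (4 : ℤ) * T.card ≤ ∑ z ∈ T, c x z + ∑ z ∈ T, c y z := by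
    rw [← sum_add_distrib, mul_comm, ← nsmul_eq_mul]
    apply card_nsmul_le_sum
    intro z hz
    have hz1 : z ≠ y := (mem_erase.1 hz).1
    have hz2 : z ≠ x := (mem_erase.1 (mem_erase.1 hz).2).1
    have := h.triple x y z hxy hz1.symm hz2.symm
    linarith
  rw [hTc] at i1 s3
  rw [tgt_odd] at i1
  rw [hS, show 2 * k + 3 = 2 * (k + 1) + 1 by ring, tgt_odd]
  push_cast at *
  nlinarith

theorem two_delete (h : Good c) {S : Finset C} {x y : C} (hx : x ∈ S) (hy : y ∈ S) (hxy : x ≠ y) :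
    f2 c S = f2 c ((S.erase x).erase y) + 2 * ∑ z ∈ S, c x z + 2 * ∑ z ∈ S, c y z - 2 * c x y := by
  have hy' : y ∈ S.erase x := mem_erase.2 ⟨hxy.symm, hy⟩
  have e1 := f2_erase h hx
  have e2 := f2_erase h hy'
  have := add_sum_erase S (fun z => c y z) hx
  rw [h.symm y x] at this
  linarith

theorem odd_case (h : Good c) {S : Finset C} {k : ℕ} (hS : S.card = 2 * k + 5)
    (ih : ∀ T : Finset C, T.card < S.card → tgt T.card ≤ f2 c T) : tgt S.card ≤ f2 c S := by
  by_cases hz : ∃ x ∈ S, ∃ y ∈ S, x ≠ y ∧ c x y = 0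
  · obtain ⟨x, hx, y, hy, hxy, h0⟩ := hz
    exact zero_pair (k := k + 1) h (by omega) ih hx hy hxy h0
  have hpos : ∀ x ∈ S, ∀ y ∈ S, x ≠ y → 1 ≤ c x y := by
    intro x hx y hy hxy
    have := h.nonneg x y
    have : c x y ≠ 0 := fun e => hz ⟨x, hx, y, hy, hxy, e⟩
    omega
  by_contra hlt
  push Not at hlt
  rw [hS, show 2 * k + 5 = 2 * (k + 2) + 1 by ring, tgt_odd] at hlt
  push_cast at hlt
  -- parity
  obtain ⟨e, he⟩ := h.parity
  obtain ⟨q, hq⟩ := f2_parity h he S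
  have hq' : ∃ q, f2 c S = 4 * q := ⟨(k + 2) * (∑ x ∈ S, e x) + q, by rw [hq, hS]; push_cast; ring⟩
  obtain ⟨q, hq⟩ := hq'
  -- deletion
  have del : ∀ x ∈ S, 8 * ((k : ℤ) + 2) * (k + 1) ≤ f2 c (S.erase x) := by
    intro x hx
    have hc : (S.erase x).card = 2 * (k + 1) + 2 := by rw [card_erase_of_mem hx, hS]; omega
    have := ih (S.erase x) (by omega)
    rw [hc, tgt_even] at this
    push_cast at this
    linarith
  have sum1 := f2_delete_sum h S
  have sum2 := card_nsmul_le_sum S _ _ del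
  rw [sum1, hS, nsmul_eq_mul] at sum2
  push_cast at sum2
  have hf : f2 c S = 8 * ((k : ℤ) + 2) * (k + 2) - 4 := by
    rw [hq] at sum2 hlt ⊢
    have hk : (0 : ℤ) ≤ k := by positivity
    have l1 : q < 2 * ((k : ℤ) + 2) * (k + 2) := by linarith
    have l2 : 2 * ((k : ℤ) + 2) * (k + 2) - 2 < q := by
      by_contra hh
      push Not at hh
      nlinarith
    have : q = 2 * ((k : ℤ) + 2) * (k + 2) - 1 := by omega
    rw [this]; ring
  -- degrees
  set g : C → ℤ := fun x => ∑ y ∈ S, c x y with hg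
  set d : C → ℤ := fun x => 4 * k + 6 - g x with hd
  have dnn : ∀ x ∈ S, 0 ≤ d x := by
    intro x hx
    have := f2_erase h hx
    have := del x hx
    simp only [hd, hg]
    nlinarith
  have dsum : ∑ x ∈ S, d x = 2 := by
    simp only [hd, sum_sub_distrib]
    rw [show ∑ x ∈ S, g x = f2 c S from rfl, hf]
    simp only [sum_const, nsmul_eq_mul, hS]
    push_cast
    ring
  have cge : ∀ x ∈ S, ∀ y ∈ S, x ≠ y → 2 - d x - d y ≤ c x y := by
    intro x hx y hy hxy
    have e1 := two_delete h hx hy hxy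
    have hy' : y ∈ S.erase x := mem_erase.2 ⟨hxy.symm, hy⟩
    have hc : ((S.erase x).erase y).card = 2 * (k + 1) + 1 := by
      rw [card_erase_of_mem hy', card_erase_of_mem hx, hS]; omega
    have := ih ((S.erase x).erase y) (by omega)
    rw [hc, tgt_odd] at this
    push_cast at this
    simp only [hd, hg]
    nlinarith
  -- sum of g outside two points
  have gsplit : ∀ x ∈ S, ∀ y ∈ S, x ≠ y → g x = c x y + ∑ z ∈ (S.erase x).erase y, c x z := by
    intro x hx y hy hxy
    have hy' : y ∈ S.erase x := mem_erase.2 ⟨hxy.symm, hy⟩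
    simp only [hg]
    rw [← add_sum_erase S _ hx, h.diag, zero_add, ← add_sum_erase _ _ hy']
  have card2 : ∀ x ∈ S, ∀ y ∈ S, x ≠ y → ((S.erase x).erase y).card = 2 * k + 3 := by
    intro x hx y hy hxy
    have hy' : y ∈ S.erase x := mem_erase.2 ⟨hxy.symm, hy⟩
    rw [card_erase_of_mem hy', card_erase_of_mem hx, hS]; omega
  have ex1 : ∃ v ∈ S, 0 < d v := by
    by_contra hh
    push Not at hh
    have := sum_nonpos hh
    omega
  obtain ⟨v, hv, hdv⟩ := ex1
  have dsum2 := add_sum_erase S d hv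
  rw [dsum] at dsum2
  have dnn' : ∀ x ∈ S.erase v, 0 ≤ d x := fun x hx => dnn x (mem_of_mem_erase hx)
  by_cases hv2 : ∑ x ∈ S.erase v, d x = 0
  · have dz : ∀ x ∈ S.erase v, d x = 0 := (sum_eq_zero_iff_of_nonneg dnn').1 hv2
    obtain ⟨x, hx⟩ : (S.erase v).Nonempty := by
      rw [← card_pos, card_erase_of_mem hv]; omega
    have hxS := mem_of_mem_erase hx
    have hxv : x ≠ v := (mem_erase.1 hx).1
    have e1 := gsplit x hxS v hv hxv
    have e2 : ((S.erase x).erase v).card • (2:ℤ) ≤ ∑ z ∈ (S.erase x).erase v, c x z := by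
      apply card_nsmul_le_sum
      intro z hz
      have hz1 : z ≠ v := (mem_erase.1 hz).1
      have hz2 : z ≠ x := (mem_erase.1 (mem_erase.1 hz).2).1
      have hz3 : z ∈ S := (mem_erase.1 (mem_erase.1 hz).2).2
      have := cge x hxS z hz3 hz2.symm
      have := dz x hx
      have := dz z (mem_erase.2 ⟨hz1, hz3⟩)
      omega
    rw [card2 x hxS v hv hxv, nsmul_eq_mul] at e2
    have e3 := hpos x hxS v hv hxv
    have e4 := dnn x hxS
    simp only [hd] at e4
    push_cast at e2
    linarith
  · have hpos2 : 0 < ∑ x ∈ S.erase v, d x := lt_of_le_of_ne (sum_nonneg dnn') (Ne.symm hv2)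
    have ex2 : ∃ w ∈ S.erase v, 0 < d w := by
      by_contra hh
      push Not at hh
      have := sum_nonpos hh
      omega
    obtain ⟨w, hw, hdw⟩ := ex2
    have hwS := mem_of_mem_erase hw
    have hwv : w ≠ v := (mem_erase.1 hw).1
    have dsum3 := add_sum_erase (S.erase v) d hw
    set T := (S.erase v).erase w with hT
    have dnnT : ∀ x ∈ T, 0 ≤ d x := fun x hx => dnn' x (mem_of_mem_erase hx)
    have := sum_nonneg dnnT
    have sT : ∑ x ∈ T, d x = 0 := by omega
    have dv1 : d v = 1 := by omega
    have dw1 : d w = 1 := by omega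
    have dz : ∀ x ∈ T, d x = 0 := (sum_eq_zero_iff_of_nonneg dnnT).1 sT
    have Tc : T.card = 2 * k + 3 := card2 v hv w hwS hwv.symm
    have memT : ∀ x, x ∈ T ↔ x ≠ w ∧ x ≠ v ∧ x ∈ S := by
      intro x; simp [hT]
    have key : ∀ x ∈ T, c x v = 1 ∧ c x w = 1 ∧ ∀ y ∈ T, y ≠ x → c x y = 2 := by
      intro x hx
      obtain ⟨xw, xv, xS⟩ := (memT x).1 hx
      have e1 := gsplit x xS v hv xv
      have hwm : w ∈ (S.erase x).erase v := by simp [hwv, xw.symm, hwS]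
      rw [← add_sum_erase _ _ hwm] at e1
      set U := ((S.erase x).erase v).erase w with hU
      have Uc : U.card = 2 * k + 2 := by
        rw [hU, card_erase_of_mem hwm, card2 x xS v hv xv]; omega
      have hUm : ∀ y, y ∈ U ↔ y ∈ T ∧ y ≠ x := by
        intro y; rw [memT]; simp [hU]; tauto
      have ge2 : ∀ y ∈ U, 0 ≤ c x y - 2 := by
        intro y hy
        have hy' := (hUm y).1 hy
        have hy'' := (memT y).1 hy'.1
        have := cge x xS y hy''.2.2 hy'.2.symm
        have := dz x hx
        have := dz y hy'.1
        omega
      have e2 : ∑ y ∈ U, (c x y - 2) = ∑ y ∈ U, c x y - 2 * (2 * k + 2) := by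
        rw [sum_sub_distrib, sum_const, Uc]; simp; ring
      have e3 := sum_nonneg ge2
      have e4 := hpos x xS v hv xv
      have e5 := hpos x xS w hwS xw
      have e6 := dz x hx
      simp only [hd] at e6
      have e7 : ∑ y ∈ U, (c x y - 2) = 0 := by linarith
      refine ⟨by linarith, by linarith, ?_⟩
      intro y hy hyx
      have := (sum_eq_zero_iff_of_nonneg ge2).1 e7 y ((hUm y).2 ⟨hy, hyx⟩)
      linarith
    have emb : ∀ m, m ≤ 2 * k + 3 → ∃ x : Fin m → C, Function.Injective x ∧ ∀ i, x i ∈ T := by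
      intro m hm
      obtain ⟨f⟩ : Nonempty (Fin m ↪ T) := by
        apply Function.Embedding.nonempty_of_card_le
        simp [Tc, hm]
      exact ⟨fun i => f i, fun i j hij => f.injective (Subtype.ext hij), fun i => (f i).2⟩
    rcases Nat.eq_zero_or_pos k with hk | hk
    · obtain ⟨x, xi, xT⟩ := emb 3 (by omega)
      refine h.x5 v w x xi (fun i => ((memT _).1 (xT i)).2.1) (fun i => ((memT _).1 (xT i)).1) hwv.symm
        ?_ (fun i => ?_) (fun i => ?_) (fun i j hij => ?_)
      · have e1 := gsplit v hv w hwS hwv.symm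
        have e2 : ∑ z ∈ T, c v z = 3 := by
          rw [sum_congr rfl (fun z hz => (h.symm v z).trans (key z hz).1)]
          simp [Tc, hk]
        rw [e2] at e1
        simp only [hd, hk] at dv1
        push_cast at dv1
        linarith
      · rw [h.symm]; exact (key _ (xT i)).1
      · rw [h.symm]; exact (key _ (xT i)).2.1
      · exact (key _ (xT i)).2.2 _ (xT j) (fun e => hij (xi e).symm)
    · obtain ⟨x, xi, xT⟩ := emb 5 (by omega)
      refine h.x7 v x xi (fun i => ((memT _).1 (xT i)).2.1) (fun i => ?_) (fun i j hij => ?_)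
      · rw [h.symm]; exact (key _ (xT i)).1
      · exact (key _ (xT i)).2.2 _ (xT j) (fun e => hij (xi e).symm)

theorem bound (h : Good c) : ∀ (n : ℕ) (S : Finset C), S.card = n → tgt n ≤ f2 c S := by
  intro n
  induction n using Nat.strong_induction_on with
  | _ n ih =>
  intro S hS
  have ih' : ∀ T : Finset C, T.card < S.card → tgt T.card ≤ f2 c T := fun T hT =>
    ih _ (hS ▸ hT) T rfl
  rw [← hS]
  rcases Nat.even_or_odd' n with ⟨k, hk | hk⟩
  · match k, hk with
    | 0, hk =>
      have : S.card = 0 := by omega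
      rw [this]
      simpa [tgt, f2] using sum_nonneg (fun x _ => sum_nonneg (fun y _ => h.nonneg x y))
    | 1, hk =>
      have : S.card = 2 := by omega
      rw [this]
      simpa [tgt, f2] using sum_nonneg (fun x _ => sum_nonneg (fun y _ => h.nonneg x y))
    | k + 2, hk =>
      have sum1 := f2_delete_sum h S
      have hc : ∀ x ∈ S, 8 * ((k : ℤ) + 1) * (k + 1) ≤ f2 c (S.erase x) := by
        intro x hx
        have hc : (S.erase x).card = 2 * (k + 1) + 1 := by rw [card_erase_of_mem hx, hS]; omega
        have := ih' (S.erase x) (by omega)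
        rw [hc, tgt_odd] at this
        push_cast at this
        linarith
      have sum2 := card_nsmul_le_sum S _ _ hc
      rw [sum1, nsmul_eq_mul] at sum2
      have hS' : S.card = 2 * (k + 1) + 2 := by omega
      rw [hS'] at sum2 ⊢
      rw [tgt_even]
      push_cast at *
      have hk0 : (0:ℤ) < 2 * (k + 1) := by positivity
      refine le_of_mul_le_mul_left ?_ hk0
      linarith
  · match k, hk with
    | 0, hk =>
      have : S.card = 1 := by omega
      rw [this]
      simpa [tgt, f2] using sum_nonneg (fun x _ => sum_nonneg (fun y _ => h.nonneg x y))
    | 1, hk =>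
      have h3 : S.card = 3 := by omega
      rw [h3]
      obtain ⟨x, y, z, hxy, hxz, hyz, rfl⟩ := card_eq_three.1 h3
      have := h.triple x y z hxy hyz hxz
      have e : f2 c {x, y, z} = 2 * (c x y + c y z + c x z) := by
        unfold f2
        simp only [sum_insert (show x ∉ ({y, z} : Finset C) by simp [hxy, hxz]),
          sum_insert (show y ∉ ({z} : Finset C) by simp [hyz]), sum_singleton, h.diag]
        rw [h.symm y x, h.symm z x, h.symm z y]; ring
      rw [e]
      simp [tgt]
      linarith
    | k + 2, hk => exact odd_case (k := k) h (by omega) ih'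

end Comb


set_option linter.unusedSectionVars false
namespace Rot
open Finset

theorem zmod2_cases (a : ZMod 2) : a = 0 ∨ a = 1 := by
  revert a; decide

theorem two0 : (2 : ZMod 2) = 0 := by decide

/-- a rotation, up to switching -/
def Cyc {α : Type*} (ρ : α → α → ZMod 2) : Prop :=
  ∃ (r : α → ℤ) (z : α → ZMod 2), Function.Injective r ∧
    ∀ v w, v ≠ w → ρ v w = z v + z w + if r v < r w then 1 else 0

def T {α : Type*} (ρ : α → α → ZMod 2) (p q r : α) : ZMod 2 := ρ p q + ρ q r + ρ r p

theorem Cyc.anti {α : Type*} {ρ : α → α → ZMod 2} (h : Cyc ρ) {v w : α} (hvw : v ≠ w) :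
    ρ w v = 1 + ρ v w := by
  obtain ⟨r, z, hr, h⟩ := h
  rw [h v w hvw, h w v hvw.symm]
  have : r v ≠ r w := fun e => hvw (hr e)
  rcases lt_or_gt_of_ne this with h1 | h1
  · rw [if_pos h1, if_neg (not_lt.2 h1.le)]; linear_combination (-1) * two0
  · rw [if_neg (not_lt.2 h1.le), if_pos h1]; ring

theorem Cyc.trans {α : Type*} {ρ : α → α → ZMod 2} (h : Cyc ρ) {p q r s : α} (hpq : p ≠ q)
    (hpr : p ≠ r) (hps : p ≠ s) (hqr : q ≠ r) (hqs : q ≠ s) (hrs : r ≠ s)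
    (e : T ρ p q r = T ρ p r s) : T ρ p q s = T ρ p q r := by
  obtain ⟨k, z, hr, h⟩ := h
  simp only [T, h p q hpq, h q r hqr, h r p hpr.symm, h p r hpr, h r s hrs, h s p hps.symm,
    h q s hqs] at e ⊢
  have n1 : k p ≠ k q := fun e => hpq (hr e)
  have n2 : k p ≠ k r := fun e => hpr (hr e)
  have n3 : k p ≠ k s := fun e => hps (hr e)
  have n4 : k q ≠ k r := fun e => hqr (hr e)
  have n5 : k q ≠ k s := fun e => hqs (hr e)
  have n6 : k r ≠ k s := fun e => hrs (hr e)
  clear h hr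
  generalize z p = a at *
  generalize z q = b at *
  generalize z r = c at *
  generalize z s = d at *
  split_ifs at e ⊢ <;> first | (exfalso; omega) | (revert a b c d; decide)

structure RS (C : Type*) where
  M : C → C → Fin 5 → Fin 5 → ZMod 2
  ρ : C → Fin 5 → Fin 5 → ZMod 2
  ρ' : Fin 5 → C → C → ZMod 2
  cyc : ∀ x, Cyc (ρ x)
  cyc' : ∀ i, Cyc (ρ' i)
  rel : ∀ x y i j, x ≠ y → i ≠ j →
    M x y i j + M x y j i = 1 + ρ x i j + ρ y i j + ρ' i x y + ρ' j x y
  symm : ∀ x y i j, x ≠ y → i ≠ j → M y x j i = M x y i j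

variable {C : Type*} [DecidableEq C]

def ind (a : ZMod 2) : ℤ := if a = 0 then 0 else 1

namespace RS

def c (R : RS C) (x y : C) : ℤ :=
  if x = y then 0 else ∑ i, ∑ j, if i = j then 0 else ind (R.M x y i j)

def m (R : RS C) (x y : C) (i j : Fin 5) : ZMod 2 := R.M x y i j + R.M x y j i

theorem m_symm (R : RS C) (x y : C) (i j : Fin 5) : R.m x y j i = R.m x y i j := add_comm _ _

end RS

def supp (f : Fin 5 → Fin 5 → ZMod 2) : Finset (Fin 5 × Fin 5) :=
  univ.filter fun p => p.1 < p.2 ∧ f p.1 p.2 ≠ 0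

def mono (t : Fin 5 → ZMod 2) : Finset (Fin 5 × Fin 5) := supp fun i j => 1 + t i + t j

theorem sum_pairs (F : Fin 5 → Fin 5 → ℤ) :
    ∑ i, ∑ j, (if i = j then 0 else F i j) =
      ∑ p : Fin 5 × Fin 5 with p.1 < p.2, (F p.1 p.2 + F p.2 p.1) := by
  rw [show (univ.filter fun p : Fin 5 × Fin 5 => p.1 < p.2) =
    {(0,1),(0,2),(0,3),(0,4),(1,2),(1,3),(1,4),(2,3),(2,4),(3,4)} by decide]
  simp [Fin.sum_univ_five]
  ring

theorem ind_add (a b : ZMod 2) : ∃ q, 0 ≤ q ∧ ind a + ind b = ind (a + b) + 2 * q := by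
  rcases zmod2_cases a with rfl | rfl <;> rcases zmod2_cases b with rfl | rfl
  · exact ⟨0, le_rfl, by decide⟩
  · exact ⟨0, le_rfl, by decide⟩
  · exact ⟨0, le_rfl, by decide⟩
  · exact ⟨1, by norm_num, by decide⟩

theorem RS.c_eq (R : RS C) {x y : C} (h : x ≠ y) :
    ∃ q, 0 ≤ q ∧ R.c x y = (supp (R.m x y)).card + 2 * q := by
  rw [RS.c, if_neg h, sum_pairs]
  choose q q0 hq using ind_add
  refine ⟨∑ p : Fin 5 × Fin 5 with p.1 < p.2, q (R.M x y p.1 p.2) (R.M x y p.2 p.1),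
    sum_nonneg fun _ _ => q0 _ _, ?_⟩
  rw [sum_congr rfl fun p _ => hq _ _, sum_add_distrib, mul_sum, supp, ← filter_filter,
    card_filter]
  push_cast
  congr 1
  apply sum_congr rfl
  intro p _
  simp only [ind, RS.m]
  split_ifs <;> simp_all

theorem RS.supp_le (R : RS C) {x y : C} (h : x ≠ y) : ((supp (R.m x y)).card : ℤ) ≤ R.c x y := by
  obtain ⟨q, h0, hq⟩ := R.c_eq h
  linarith

theorem mono_card (t : Fin 5 → ZMod 2) : 4 ≤ (mono t).card := by
  have key : ∀ a b c d e : ZMod 2, 4 ≤ (mono ![a, b, c, d, e]).card := by decide +kernel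
  have : t = ![t 0, t 1, t 2, t 3, t 4] := by
    ext i; fin_cases i <;> rfl
  rw [this]; exact key _ _ _ _ _

theorem RS.tri (R : RS C) {x y z : C} (hxy : x ≠ y) (hyz : y ≠ z) (hxz : x ≠ z) {i j : Fin 5}
    (hij : i ≠ j) : R.m x y i j + R.m y z i j + R.m x z i j =
      1 + T (R.ρ' i) x y z + T (R.ρ' j) x y z := by
  simp only [RS.m, R.rel x y i j hxy hij, R.rel y z i j hyz hij, R.rel x z i j hxz hij, T,
    (R.cyc' i).anti hxz, (R.cyc' j).anti hxz]
  linear_combination (R.ρ x i j + R.ρ y i j + R.ρ z i j) * two0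

theorem RS.mono_sub (R : RS C) {x y z : C} (hxy : x ≠ y) (hyz : y ≠ z) (hxz : x ≠ z) :
    mono (fun i => T (R.ρ' i) x y z) ⊆ supp (R.m x y) ∪ supp (R.m y z) ∪ supp (R.m x z) := by
  intro p hp
  simp only [mono, supp, mem_filter, mem_univ, true_and, mem_union] at hp ⊢
  rw [← R.tri hxy hyz hxz hp.1.ne] at hp
  by_contra hh
  push Not at hh
  apply hp.2
  rw [hh.1.1 hp.1, hh.1.2 hp.1, hh.2 hp.1]; decide

theorem RS.triple4 (R : RS C) {x y z : C} (hxy : x ≠ y) (hyz : y ≠ z) (hxz : x ≠ z) :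
    4 ≤ (supp (R.m x y)).card + (supp (R.m y z)).card + (supp (R.m x z)).card := by
  have h1 := mono_card (fun i => T (R.ρ' i) x y z)
  have h2 := card_le_card (R.mono_sub hxy hyz hxz)
  have h3 := card_union_le (supp (R.m x y) ∪ supp (R.m y z)) (supp (R.m x z))
  have h4 := card_union_le (supp (R.m x y)) (supp (R.m y z))
  omega

/-- tight triples -/
theorem RS.tight (R : RS C) {x y z : C} (hxy : x ≠ y) (hyz : y ≠ z) (hxz : x ≠ z)
    (h : (supp (R.m x y)).card + (supp (R.m y z)).card + (supp (R.m x z)).card ≤ 4) :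
    (mono (fun i => T (R.ρ' i) x y z)).card = 4 ∧
    mono (fun i => T (R.ρ' i) x y z) = supp (R.m x y) ∪ supp (R.m y z) ∪ supp (R.m x z) ∧
    Disjoint (supp (R.m x y)) (supp (R.m y z)) ∧ Disjoint (supp (R.m x y)) (supp (R.m x z)) ∧
    Disjoint (supp (R.m y z)) (supp (R.m x z)) := by
  have h1 := mono_card (fun i => T (R.ρ' i) x y z)
  have h2 := card_le_card (R.mono_sub hxy hyz hxz)
  have h3 := card_union_le (supp (R.m x y) ∪ supp (R.m y z)) (supp (R.m x z))
  have h4 := card_union_le (supp (R.m x y)) (supp (R.m y z))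
  refine ⟨by omega, eq_of_subset_of_card_le (R.mono_sub hxy hyz hxz) (by omega), ?_⟩
  have a1 : Disjoint (supp (R.m x y)) (supp (R.m y z)) := by
    rw [← card_union_eq_card_add_card]; omega
  have a2 : Disjoint (supp (R.m x y) ∪ supp (R.m y z)) (supp (R.m x z)) := by
    rw [← card_union_eq_card_add_card]; omega
  rw [disjoint_union_left] at a2
  exact ⟨a1, a2.1, a2.2⟩

theorem supp_zmod (f : Fin 5 → Fin 5 → ZMod 2) :
    ((supp f).card : ZMod 2) = ∑ p : Fin 5 × Fin 5 with p.1 < p.2, f p.1 p.2 := by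
  rw [supp, ← filter_filter, card_filter]
  push_cast
  apply sum_congr rfl
  intro p _
  rcases zmod2_cases (f p.1 p.2) with h | h <;> simp [h]

theorem pairs_ten (f : Fin 5 → Fin 5 → ZMod 2) : ∑ p : Fin 5 × Fin 5 with p.1 < p.2, f p.1 p.2 =
    f 0 1 + f 0 2 + f 0 3 + f 0 4 + f 1 2 + f 1 3 + f 1 4 + f 2 3 + f 2 4 + f 3 4 := by
  rw [show (univ.filter fun p : Fin 5 × Fin 5 => p.1 < p.2) =
    {(0,1),(0,2),(0,3),(0,4),(1,2),(1,3),(1,4),(2,3),(2,4),(3,4)} by decide]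
  simp
  ring

theorem RS.parity (R : RS C) : ∃ e : C → ℤ, ∀ x y, x ≠ y → ∃ q, R.c x y = e x + e y + 2 * q := by
  let S : C → ZMod 2 := fun x => ∑ p : Fin 5 × Fin 5 with p.1 < p.2, R.ρ x p.1 p.2
  refine ⟨fun x => ((S x).val : ℤ), ?_⟩
  intro x y hxy
  obtain ⟨q, -, hq⟩ := R.c_eq hxy
  have key : ((supp (R.m x y)).card : ZMod 2) = S x + S y := by
    rw [supp_zmod]
    have : ∀ i j : Fin 5, i ≠ j → R.m x y i j = 1 + R.ρ x i j + R.ρ y i j + R.ρ' i x y + R.ρ' j x y :=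
      fun i j hij => R.rel x y i j hxy hij
    simp only [S]
    rw [pairs_ten, pairs_ten, pairs_ten]
    rw [this 0 1 (by decide), this 0 2 (by decide), this 0 3 (by decide), this 0 4 (by decide),
      this 1 2 (by decide), this 1 3 (by decide), this 1 4 (by decide), this 2 3 (by decide),
      this 2 4 (by decide), this 3 4 (by decide)]
    linear_combination (5 + 2 * R.ρ' 0 x y + 2 * R.ρ' 1 x y + 2 * R.ρ' 2 x y + 2 * R.ρ' 3 x y +
      2 * R.ρ' 4 x y) * two0
  have h2 : (((supp (R.m x y)).card : ℤ) : ZMod 2) = (((S x).val + (S y).val : ℤ) : ZMod 2) := by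
    push_cast
    rw [key]; simp
  rw [ZMod.intCast_eq_intCast_iff_dvd_sub] at h2
  obtain ⟨k, hk⟩ := h2
  refine ⟨q - k, ?_⟩
  rw [hq]
  push_cast at hk
  linarith

def RS.relabel (R : RS C) (π : Equiv.Perm (Fin 5)) : RS C where
  M x y i j := R.M x y (π i) (π j)
  ρ x i j := R.ρ x (π i) (π j)
  ρ' i := R.ρ' (π i)
  cyc x := by
    obtain ⟨r, z, hr, h⟩ := R.cyc x
    exact ⟨r ∘ π, z ∘ π, hr.comp π.injective, fun v w hvw => h _ _ (π.injective.ne hvw)⟩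
  cyc' i := R.cyc' _
  rel x y i j hxy hij := R.rel x y _ _ hxy (π.injective.ne hij)
  symm x y i j hxy hij := R.symm x y _ _ hxy (π.injective.ne hij)

theorem RS.relabel_c (R : RS C) (π : Equiv.Perm (Fin 5)) : (R.relabel π).c = R.c := by
  funext x y
  simp only [RS.c, RS.relabel]
  split_ifs with h
  · rfl
  · rw [← Equiv.sum_comp π (fun i => ∑ j, if i = j then 0 else ind (R.M x y i j))]
    apply sum_congr rfl
    intro i _
    rw [← Equiv.sum_comp π (fun j => if π i = j then 0 else ind (R.M x y (π i) j))]
    simp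

def RS.Std (R : RS C) (v : C) : Prop := ∃ z : Fin 5 → ZMod 2, ∀ i j, i ≠ j →
  R.ρ v i j = z i + z j + if i < j then 1 else 0

theorem RS.exists_std (R : RS C) (v : C) : ∃ π, (R.relabel π).Std v := by
  obtain ⟨r, z, hr, h⟩ := R.cyc v
  refine ⟨Tuple.sort r, z ∘ Tuple.sort r, ?_⟩
  intro i j hij
  have hm : StrictMono (r ∘ Tuple.sort r) :=
    (Tuple.monotone_sort r).strictMono_of_injective (hr.comp (Equiv.injective _))
  have := h (Tuple.sort r i) (Tuple.sort r j) ((Equiv.injective _).ne hij)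
  simp only [RS.relabel]
  rw [this]
  have h2 : r (Tuple.sort r i) < r (Tuple.sort r j) ↔ i < j := hm.lt_iff_lt
  simp only [h2, Function.comp]

def E (k : Fin 5) : Fin 5 × Fin 5 := if k = 4 then (0, 4) else (k, k + 1)

def Tstd (p q r : Fin 5) : ZMod 2 :=
  (if p < q then 1 else 0) + (if q < r then 1 else 0) + (if r < p then 1 else 0)

def Iab (a b i j : Fin 5) : ZMod 2 := if (i = a ∧ j = b) ∨ (i = b ∧ j = a) then 1 else 0

def Tab (a b p q r : Fin 5) : ZMod 2 := Tstd p q r + 1 + (Iab a b p q + Iab a b q r + Iab a b r p)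

def TransOk (a b p q r s : Fin 5) : Bool := decide ((p ≠ q ∧ p ≠ r ∧ p ≠ s ∧ q ≠ r ∧ q ≠ s ∧
    r ≠ s ∧ Tab a b p q r = Tab a b p r s) → Tab a b p q s = Tab a b p q r)

theorem consec_fin : ∀ a b : Fin 5, a < b → (∀ p q r s : Fin 5, TransOk a b p q r s = true) →
    ∃ k, (a, b) = E k := by
  decide +kernel

theorem RS.consec (R : RS C) {v x : C} (hvx : v ≠ x) (hs : R.Std v)
    (h1 : (supp (R.m v x)).card = 1) : ∃ k, supp (R.m v x) = {E k} := by
  obtain ⟨⟨a, b⟩, hab⟩ := card_eq_one.1 h1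
  obtain ⟨z, hz⟩ := hs
  have hm : (a, b) ∈ supp (R.m v x) := by rw [hab]; simp
  have hlt : a < b := by simp only [supp, mem_filter] at hm; exact hm.2.1
  have mval' : ∀ i j : Fin 5, i < j → R.m v x i j = Iab a b i j := by
    intro i j hij
    have h2 : (i, j) ∈ supp (R.m v x) ↔ (i, j) = (a, b) := by rw [hab]; simp
    simp only [supp, mem_filter, mem_univ, true_and, hij, Prod.mk.injEq] at h2
    unfold Iab
    split_ifs with hc
    · rcases hc with hc | hc
      · exact (zmod2_cases _).resolve_left (h2.2 hc)
      · exfalso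
        rw [hc.1, hc.2] at hij
        exact absurd hij (not_lt.2 hlt.le)
    · by_contra hne
      exact hc (Or.inl (h2.1 hne))
  have mval : ∀ i j : Fin 5, i ≠ j → R.m v x i j = Iab a b i j := by
    intro i j hij
    rcases lt_or_gt_of_ne hij with h | h
    · exact mval' i j h
    · rw [R.m_symm, mval' j i h]
      unfold Iab
      congr 1
      apply propext; tauto
  have rx : ∀ i j : Fin 5, i ≠ j → R.ρ x i j = Iab a b i j + 1 + z i + z j +
      (if i < j then 1 else 0) + R.ρ' i v x + R.ρ' j v x := by
    intro i j hij
    have := R.rel v x i j hvx hij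
    rw [show R.M v x i j + R.M v x j i = R.m v x i j from rfl, mval i j hij, hz i j hij] at this
    rw [this]
    linear_combination (-1 - z i - z j - (if i < j then 1 else 0) - R.ρ' i v x - R.ρ' j v x) * two0
  have tx : ∀ p q r : Fin 5, p ≠ q → q ≠ r → r ≠ p → T (R.ρ x) p q r = Tab a b p q r := by
    intro p q r h1 h2 h3
    simp only [T, rx p q h1, rx q r h2, rx r p h3, Tab, Tstd]
    linear_combination (1 + z p + z q + z r + R.ρ' p v x + R.ρ' q v x + R.ρ' r v x) * two0
  obtain ⟨k, hk⟩ := consec_fin a b hlt (by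
    intro p q r s
    unfold TransOk
    rw [decide_eq_true_iff]
    rintro ⟨pq, pr, ps, qr, qs, rs, e⟩
    rw [← tx p q r pq qr pr.symm, ← tx p r s pr rs ps.symm] at e
    rw [← tx p q r pq qr pr.symm, ← tx p q s pq qs ps.symm]
    exact (R.cyc x).trans pq pr ps qr qs rs e)
  exact ⟨k, by rw [hab, hk]⟩

theorem mem_mono (t : Fin 5 → ZMod 2) (p : Fin 5 × Fin 5) : p ∈ mono t ↔ p.1 < p.2 ∧ t p.1 = t p.2 := by
  simp only [mono, supp, mem_filter, mem_univ, true_and]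
  refine and_congr_right fun _ => ?_
  generalize t p.1 = a
  generalize t p.2 = b
  revert a b; decide

theorem E_mono (t : Fin 5 → ZMod 2) (k : Fin 5) : E k ∈ mono t ↔ t k = t (k + 1) := by
  rw [mem_mono]
  fin_cases k <;> simp [E] ; exact eq_comm

theorem E_inj : ∀ k l, E k = E l → k = l := by decide

theorem mono_four_fin : ∀ a b c d e : ZMod 2, (mono ![a, b, c, d, e]).card = 4 → ∀ k : Fin 5,
    ![a, b, c, d, e] k = ![a, b, c, d, e] (k + 1) → ![a, b, c, d, e] (k + 2) = ![a, b, c, d, e] (k + 3) →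
    ![a, b, c, d, e] (k + 1) ≠ ![a, b, c, d, e] (k + 2) := by decide +kernel

theorem mono_four (t : Fin 5 → ZMod 2) (h : (mono t).card = 4) (k : Fin 5) (h1 : t k = t (k + 1))
    (h2 : t (k + 2) = t (k + 3)) : t (k + 1) ≠ t (k + 2) := by
  have : t = ![t 0, t 1, t 2, t 3, t 4] := by
    ext i; fin_cases i <;> rfl
  rw [this] at h h1 h2 ⊢
  exact mono_four_fin _ _ _ _ _ h k h1 h2

theorem RS.supp_one (R : RS C) {x y : C} (h : x ≠ y) (h1 : R.c x y = 1) : (supp (R.m x y)).card = 1 := by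
  obtain ⟨q, h0, hq⟩ := R.c_eq h
  omega

theorem fin5_facts : ∀ i : Fin 5, i ≠ i + 1 ∧ i + 1 ≠ i + 2 ∧ i ≠ i + 2 ∧ i + 1 + 1 = i + 2 ∧
    i + 2 + 1 = i + 3 := by decide

theorem RS.x7 (R : RS C) (v : C) (hs : R.Std v) (x : Fin 5 → C) (xi : Function.Injective x)
    (xv : ∀ i, x i ≠ v) (h1 : ∀ i, R.c v (x i) = 1) (h2 : ∀ i j, i ≠ j → R.c (x i) (x j) = 2) :
    False := by
  choose k hk using fun i => R.consec (xv i).symm hs (R.supp_one (xv i).symm (h1 i))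
  have le4 : ∀ i j, i ≠ j → (supp (R.m v (x i))).card + (supp (R.m (x i) (x j))).card +
      (supp (R.m v (x j))).card ≤ 4 := by
    intro i j hij
    have a := R.supp_one (xv i).symm (h1 i)
    have b := R.supp_one (xv j).symm (h1 j)
    have d := R.supp_le (xi.ne hij)
    rw [h2 i j hij] at d
    omega
  have tight := fun i j (hij : i ≠ j) => R.tight (xv i).symm (xi.ne hij) (xv j).symm (le4 i j hij)
  have kinj : Function.Injective k := by
    intro i j hij
    by_contra hne
    have := (tight i j hne).2.2.2.1
    rw [hk i, hk j, hij] at this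
    simp at this
  have kb : Function.Bijective k := Finite.injective_iff_bijective.1 kinj
  let kk := Equiv.ofBijective k kb
  let y : Fin 5 → C := fun i => x (kk.symm i)
  have yi : Function.Injective y := xi.comp kk.symm.injective
  have yv : ∀ i, y i ≠ v := fun i => xv _
  have hy : ∀ i, supp (R.m v (y i)) = {E i} := by
    intro i
    simp only [y]
    rw [hk]
    congr 2
    exact Equiv.ofBijective_apply_symm_apply k kb i
  have tg : ∀ i j, i ≠ j → (mono (fun l => T (R.ρ' l) v (y i) (y j))).card = 4 ∧
      E i ∈ mono (fun l => T (R.ρ' l) v (y i) (y j)) ∧ E j ∈ mono (fun l => T (R.ρ' l) v (y i) (y j)) := by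
    intro i j hij
    have := tight (kk.symm i) (kk.symm j) (kk.symm.injective.ne hij)
    refine ⟨this.1, ?_, ?_⟩
    · rw [this.2.1]
      have : E i ∈ supp (R.m v (y i)) := by rw [hy]; simp
      simp only [mem_union]; exact Or.inl (Or.inl this)
    · rw [this.2.1]
      have : E j ∈ supp (R.m v (y j)) := by rw [hy]; simp
      simp only [mem_union]; exact Or.inr this
  let s : Fin 5 → ZMod 2 := fun i => T (R.ρ' (i + 1)) v (y i) (y (i + 1))
  have alt : ∀ i, s i ≠ s (i + 1) := by
    intro i hs
    obtain ⟨ne1, ne2, ne3, e1, e3⟩ := fin5_facts i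
    obtain ⟨-, a1, a2⟩ := tg i (i + 1) ne1
    obtain ⟨-, b1, b2⟩ := tg (i + 1) (i + 2) ne2
    obtain ⟨c0, c1, c2⟩ := tg i (i + 2) ne3
    rw [E_mono] at a1 a2 b1 b2 c1 c2
    rw [e3] at c2
    have := mono_four _ c0 i c1 c2
    apply this
    simp only [s] at hs
    rw [e1] at hs a2 b1
    have t1 := (R.cyc' (i + 1)).trans (yv i).symm (yv (i + 1)).symm (yv (i + 2)).symm (yi.ne ne1)
      (yi.ne ne3) (yi.ne ne2) (by rw [hs, b1])
    have t2 := (R.cyc' (i + 2)).trans (yv i).symm (yv (i + 1)).symm (yv (i + 2)).symm (yi.ne ne1)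
      (yi.ne ne3) (yi.ne ne2) (by rw [← hs, a2])
    rw [t1, t2, a2]
  have odd : ∀ a b c d e : ZMod 2, ¬ (a ≠ b ∧ b ≠ c ∧ c ≠ d ∧ d ≠ e ∧ e ≠ a) := by decide
  exact odd _ _ _ _ _ ⟨alt 0, alt 1, alt 2, alt 3, alt 4⟩

def allowed (p q : Fin 5 × Fin 5) (k : Fin 5) : Prop :=
  ∃ a b c d e : ZMod 2, (mono ![a, b, c, d, e]).card = 4 ∧ p ∈ mono ![a, b, c, d, e] ∧
    q ∈ mono ![a, b, c, d, e] ∧ E k ∈ mono ![a, b, c, d, e] ∧ E k ≠ p ∧ E k ≠ q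

instance (p q : Fin 5 × Fin 5) (k : Fin 5) : Decidable (allowed p q k) := by
  unfold allowed; infer_instance

theorem allowed_fin : ∀ p q : Fin 5 × Fin 5, p.1 < p.2 → q.1 < q.2 → p ≠ q →
    (univ.filter fun k => allowed p q k).card ≤ 2 := by decide +kernel

theorem RS.x5 (R : RS C) (v w : C) (hs : R.Std v) (x : Fin 3 → C) (xi : Function.Injective x)
    (xv : ∀ i, x i ≠ v) (xw : ∀ i, x i ≠ w) (hvw : v ≠ w) (h0 : R.c v w = 2)
    (h1 : ∀ i, R.c v (x i) = 1) (h1' : ∀ i, R.c w (x i) = 1)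
    (h2 : ∀ i j, i ≠ j → R.c (x i) (x j) = 2) : False := by
  choose k hk using fun i => R.consec (xv i).symm hs (R.supp_one (xv i).symm (h1 i))
  have le4 : ∀ i j, i ≠ j → (supp (R.m v (x i))).card + (supp (R.m (x i) (x j))).card +
      (supp (R.m v (x j))).card ≤ 4 := by
    intro i j hij
    have a := R.supp_one (xv i).symm (h1 i)
    have b := R.supp_one (xv j).symm (h1 j)
    have d := R.supp_le (xi.ne hij)
    rw [h2 i j hij] at d
    omega
  have kinj : Function.Injective k := by
    intro i j hij
    by_contra hne
    have := (R.tight (xv i).symm (xi.ne hne) (xv j).symm (le4 i j hne)).2.2.2.1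
    rw [hk i, hk j, hij] at this
    simp at this
  have a := fun i => R.supp_one (xv i).symm (h1 i)
  have b := fun i => R.supp_one (xw i).symm (h1' i)
  have d := R.supp_le hvw
  rw [h0] at d
  have tri0 := R.triple4 hvw (xw 0).symm (xv 0).symm
  have dd : (supp (R.m v w)).card = 2 := by have := a 0; have := b 0; omega
  obtain ⟨p, q, hpq, hsupp⟩ := card_eq_two.1 dd
  have hp : p ∈ supp (R.m v w) := by rw [hsupp]; simp
  have hq : q ∈ supp (R.m v w) := by rw [hsupp]; simp
  have all : ∀ i, allowed p q (k i) := by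
    intro i
    have := R.tight hvw (xw i).symm (xv i).symm (by have := a i; have := b i; omega)
    set t := (fun l => T (R.ρ' l) v w (x i)) with ht
    have te : t = ![t 0, t 1, t 2, t 3, t 4] := by
      ext i; fin_cases i <;> rfl
    refine ⟨t 0, t 1, t 2, t 3, t 4, ?_⟩
    rw [← te]
    obtain ⟨c1, c2, -, c3, -⟩ := this
    have hE : E (k i) ∈ supp (R.m v (x i)) := by rw [hk]; simp
    have hE2 : E (k i) ∉ supp (R.m v w) := disjoint_right.1 c3 hE
    refine ⟨c1, ?_, ?_, ?_, ?_, ?_⟩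
    · rw [c2]; simp [hp]
    · rw [c2]; simp [hq]
    · rw [c2]; simp [hE]
    · rintro rfl; exact hE2 hp
    · rintro rfl; exact hE2 hq
  have lt : ∀ {p}, p ∈ supp (R.m v w) → p.1 < p.2 := by
    intro p hp; simp only [supp, mem_filter] at hp; exact hp.2.1
  have := allowed_fin p q (lt hp) (lt hq) hpq
  have h3 : (univ.image k).card ≤ (univ.filter fun k => allowed p q k).card := by
    apply card_le_card
    intro l hl
    obtain ⟨i, -, rfl⟩ := mem_image.1 hl
    simpa using all i
  rw [card_image_of_injective _ kinj] at h3
  simp at h3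
  omega

theorem RS.good (R : RS C) : Comb.Good R.c where
  nonneg x y := by
    unfold RS.c
    split_ifs
    · exact le_rfl
    · refine sum_nonneg fun i _ => sum_nonneg fun j _ => ?_
      unfold ind
      split_ifs <;> norm_num
  symm x y := by
    unfold RS.c
    by_cases h : x = y
    · rw [if_pos h, if_pos h.symm]
    · rw [if_neg h, if_neg (Ne.symm h), sum_comm]
      refine sum_congr rfl fun i _ => sum_congr rfl fun j _ => ?_
      by_cases hij : i = j
      · rw [if_pos hij, if_pos hij.symm]
      · rw [if_neg hij, if_neg (Ne.symm hij), R.symm x y j i h (Ne.symm hij)]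
  diag x := by simp [RS.c]
  parity := R.parity
  triple x y z hxy hyz hxz := by
    have := R.triple4 hxy hyz hxz
    have := R.supp_le hxy
    have := R.supp_le hyz
    have := R.supp_le hxz
    omega
  x5 v w x xi xv xw hvw h0 h1 h1' h2 := by
    obtain ⟨π, hπ⟩ := R.exists_std v
    rw [← R.relabel_c π] at h0 h1 h1' h2
    exact (R.relabel π).x5 v w hπ x xi xv xw hvw h0 h1 h1' h2
  x7 v x xi xv h1 h2 := by
    obtain ⟨π, hπ⟩ := R.exists_std v
    rw [← R.relabel_c π] at h1 h2
    exact (R.relabel π).x7 v hπ x xi xv h1 h2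

end Rot


namespace Rot
open Finset

theorem cyc_of_int {α : Type*} [Fintype α] (ν : α → α → ℤ)
    (anti : ∀ v w, v ≠ w → ν w v = 1 - ν v w)
    (tri : ∀ v w z, v ≠ w → w ≠ z → z ≠ v → ν v w + ν w z + ν z v = 1 ∨ ν v w + ν w z + ν z v = 2) :
    Cyc (fun v w => (ν v w : ZMod 2)) := by
  classical
  by_cases hα : IsEmpty α
  · exact ⟨fun _ => 0, fun _ => 0, fun v => hα.elim v, fun v => hα.elim v⟩
  rw [not_isEmpty_iff] at hα
  obtain ⟨v0⟩ := hα
  let n : α → ℤ := fun v => if v = v0 then 0 else ν v0 v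
  let σ : α → α → ℤ := fun v w => ν v w - n w + n v
  have σanti : ∀ v w, v ≠ w → σ w v = 1 - σ v w := by
    intro v w h
    simp only [σ, anti v w h]; ring
  have σ01 : ∀ v w, v ≠ w → σ v w = 0 ∨ σ v w = 1 := by
    intro v w h
    by_cases hv : v = v0
    · subst hv
      left
      simp [σ, n, h.symm]
    · by_cases hw : w = v0
      · subst hw
        right
        simp only [σ, n, if_true, if_neg h, anti w v h.symm]; ring
      · have := tri v0 v w (Ne.symm hv) h hw
        have h2 := anti v0 w (Ne.symm hw)
        simp only [σ, n, if_neg hv, if_neg hw]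
        omega
  have σtr : ∀ u v w, u ≠ v → v ≠ w → u ≠ w → σ u v = 1 → σ v w = 1 → σ u w = 1 := by
    intro u v w h1 h2 h3 a b
    have := tri u v w h1 h2 h3.symm
    have c := anti u w h3
    have d := σ01 u w h3
    simp only [σ] at *
    omega
  let S : α → Finset α := fun v => univ.filter fun w => w ≠ v ∧ σ w v = 1
  have key : ∀ v w, v ≠ w → σ v w = 1 → (S v).card < (S w).card := by
    intro v w h hs
    apply card_lt_card
    rw [ssubset_iff_of_subset]
    · exact ⟨v, by simp [S, h, hs], by simp [S]⟩
    · intro u hu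
      simp only [S, mem_filter, mem_univ, true_and] at hu ⊢
      by_cases huw : u = w
      · exfalso
        subst huw
        have := σanti v u h
        have := hu.2
        omega
      · exact ⟨huw, σtr u v w hu.1 h huw hu.2 hs⟩
  have key2 : ∀ v w, v ≠ w → (((S v).card : ℤ) < (S w).card ↔ σ v w = 1) := by
    intro v w h
    constructor
    · intro hlt
      rcases σ01 v w h with h0 | h0
      · have := key w v h.symm (by rw [σanti v w h, h0]; norm_num)
        omega
      · exact h0
    · intro h0
      exact_mod_cast key v w h h0
  refine ⟨fun v => (S v).card, fun v => (n v : ZMod 2), ?_, ?_⟩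
  · intro v w hvw
    by_contra h
    simp only at hvw
    rcases σ01 v w h with h0 | h0
    · have := key w v (Ne.symm h) (by rw [σanti v w h, h0]; norm_num)
      omega
    · have := key v w h h0
      omega
  · intro v w h
    have e : ν v w = σ v w + n w - n v := by simp only [σ]; ring
    simp only [key2 v w h]
    rcases σ01 v w h with h0 | h0
    · rw [if_neg (by omega), e, h0]
      push_cast
      linear_combination (-(n v : ZMod 2)) * two0
    · rw [if_pos h0, e, h0]
      push_cast
      linear_combination (-(n v : ZMod 2)) * two0

end Rot

namespace Topo
open Rot

namespace Data
variable {V : Type*} {G : SimpleGraph V} {D : Drawing G} (A : Data D)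

def oi (u v : V) : ℤ := if A.h u v = 1 then 0 else 1
def o (u v : V) : ZMod 2 := (A.oi u v : ZMod 2)
def kap (u v w : V) : ZMod 2 := (A.k u v w : ZMod 2)
def nu (u v w : V) : ℤ := A.oi v w - A.k u v w + A.k u w v
def rho (u v w : V) : ZMod 2 := (A.nu u v w : ZMod 2)
def Mv (a b c d : V) : ZMod 2 := A.o b c + A.o a c + A.o b d + A.o a d + A.kap a b c + A.kap a b d +
  A.kap c d b + A.kap c d a

theorem h_oi {u v : V} (huv : u ≠ v) : A.h u v = 1 - 2 * A.oi u v := by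
  unfold oi
  rcases A.h_one u v huv with h | h <;> rw [h] <;> simp

theorem oi_anti {u v : V} (huv : u ≠ v) : A.oi v u = 1 - A.oi u v := by
  have h1 := A.h_oi huv
  have h2 := A.h_oi huv.symm
  have h3 := A.h_neg u v
  omega

theorem o_anti {u v : V} (huv : u ≠ v) : A.o v u = 1 + A.o u v := by
  unfold o
  rw [A.oi_anti huv]
  push_cast
  linear_combination (-(A.oi u v : ZMod 2)) * two0

theorem kap_symm {u v w : V} (h : G.Adj u v) (h1 : w ≠ u) (h2 : w ≠ v) : A.kap v u w = A.kap u v w := by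
  unfold kap
  rw [A.k_neg u v w h h1 h2]
  push_cast
  linear_combination (-(A.k u v w : ZMod 2)) * two0

theorem rho_eq (u v w : V) : A.rho u v w = A.o v w + A.kap u v w + A.kap u w v := by
  unfold rho nu o kap
  push_cast
  linear_combination (-(A.k u v w : ZMod 2)) * two0

theorem cross_of {a b c d : V} (ab : G.Adj a b) (cd : G.Adj c d) (ac : a ≠ c) (ad : a ≠ d) (bc : b ≠ c)
    (bd : b ≠ d) (h : A.Mv a b c d ≠ 0) : ∃ p, D.IsCrossing s(a, b) s(c, d) p := by
  apply A.cross a b c d ab cd ac ad bc bd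
  intro h0
  apply h
  rw [A.h_oi bc, A.h_oi ac, A.h_oi bd, A.h_oi ad] at h0
  have h1 : -A.oi b c + A.oi a c + A.oi b d - A.oi a d + A.k a b c - A.k a b d + A.k c d b - A.k c d a = 0 := by
    omega
  have h2 := congrArg (fun t : ℤ => (t : ZMod 2)) h1
  push_cast at h2
  unfold Mv o kap
  linear_combination h2 + ((A.oi b c : ZMod 2) + A.oi a d + A.k a b d + A.k c d a) * two0

theorem Mv_symm (a b c d : V) (ac : a ≠ c) (ad : a ≠ d) (bc : b ≠ c) (bd : b ≠ d) :
    A.Mv c d a b = A.Mv a b c d := by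
  unfold Mv
  rw [A.o_anti ac, A.o_anti ad, A.o_anti bc, A.o_anti bd]
  linear_combination 2 * two0

theorem cyc_rho {α : Type*} [Fintype α] (u : V) (f : α → V) (hf : Function.Injective f)
    (hadj : ∀ x, G.Adj u (f x)) : Cyc (fun x y => A.rho u (f x) (f y)) := by
  apply cyc_of_int (fun x y => A.nu u (f x) (f y))
  · intro v w h
    unfold nu
    rw [A.oi_anti (hf.ne h)]; ring
  · intro v w z h1 h2 h3
    have := A.rot u (f v) (f w) (f z) (hadj v) (hadj w) (hadj z) (hf.ne h1) (hf.ne h2) (hf.ne h3)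
    rw [A.h_oi (hf.ne h1), A.h_oi (hf.ne h2), A.h_oi (hf.ne h3)] at this
    unfold nu
    omega

/-- the switched rotation -/
def rhos (u v w : V) : ZMod 2 := A.rho u v w + A.o u v + A.o u w

theorem Mv_rel {x y i j : V} (xi : G.Adj x i) (xj : G.Adj x j) (yi : G.Adj y i) (yj : G.Adj y j)
    (xy : x ≠ y) (ij : i ≠ j) : A.Mv x i y j + A.Mv x j y i =
      1 + A.rhos x i j + A.rhos y i j + A.rho i x y + A.rho j x y := by
  unfold rhos Mv
  simp only [rho_eq]
  rw [A.o_anti ij, A.o_anti yi.ne, A.o_anti yj.ne, A.kap_symm xi xy.symm yi.ne, A.kap_symm yi xy xi.ne,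
    A.kap_symm xj xy.symm yj.ne, A.kap_symm yj xy xj.ne]
  ring_nf
  linear_combination (1 : ZMod 2) * two0

end Data
end Topo


namespace Rot
open Finset

/-- Build a rotation structure from data on ordered pairs. -/
def RS.ofHalf {C : Type*} [LinearOrder C] (N : C → C → Fin 5 → Fin 5 → ZMod 2)
    (ρ : C → Fin 5 → Fin 5 → ZMod 2) (ρ' : Fin 5 → C → C → ZMod 2)
    (cyc : ∀ x, Cyc (ρ x)) (cyc' : ∀ i, Cyc (ρ' i))
    (rel : ∀ x y i j, x < y → i < j →
      N x y i j + N x y j i = 1 + ρ x i j + ρ y i j + ρ' i x y + ρ' j x y) : RS C where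
  M := fun x y i j => if x < y then N x y i j else N y x j i
  ρ := ρ
  ρ' := ρ'
  cyc := cyc
  cyc' := cyc'
  rel := by
    have key : ∀ x y i j, x < y → i ≠ j →
        N x y i j + N x y j i = 1 + ρ x i j + ρ y i j + ρ' i x y + ρ' j x y := by
      intro x y i j hxy hij
      rcases lt_or_gt_of_ne hij with h | h
      · exact rel x y i j hxy h
      · have := rel x y j i hxy h
        rw [(cyc x).anti hij, (cyc y).anti hij] at this
        linear_combination this + two0
    intro x y i j hxy hij
    rcases lt_or_gt_of_ne hxy with h | h
    · simp only [if_pos h]; exact key x y i j h hij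
    · simp only [if_neg h.not_gt]
      have := key y x i j h hij
      rw [(cyc' i).anti hxy, (cyc' j).anti hxy] at this
      linear_combination this + two0
  symm := by
    intro x y i j hxy hij
    rcases lt_or_gt_of_ne hxy with h | h
    · simp only [if_pos h, if_neg h.not_gt]
    · simp only [if_pos h, if_neg h.not_gt]

theorem f2_half {C : Type*} [LinearOrder C] [Fintype C] (c : C → C → ℤ) (h0 : ∀ x, c x x = 0)
    (hs : ∀ x y, c x y = c y x) :
    Comb.f2 c univ = 2 * ∑ x, ∑ y, if x < y then c x y else 0 := by
  have : ∀ x y, c x y = (if x < y then c x y else 0) + (if y < x then c y x else 0) := by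
    intro x y
    rcases lt_trichotomy x y with h | h | h
    · simp [h, h.not_gt]
    · subst h; simp [h0]
    · simp [h, h.not_gt, hs x y]
  unfold Comb.f2
  rw [Finset.sum_congr rfl (fun x _ => Finset.sum_congr rfl (fun y _ => this x y))]
  simp only [Finset.sum_add_distrib]
  rw [Finset.sum_comm (f := fun x y => if y < x then c y x else 0)]
  ring

end Rot

namespace Topo
variable {V : Type*} {G : SimpleGraph V}

theorem isCrossing_symm {D : Drawing G} {e f : Sym2 V} {p : ℝ × ℝ} (h : D.IsCrossing e f p) :
    D.IsCrossing f e p := by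
  obtain ⟨h1, h2, h3, h4, h5, h6, h7⟩ := h
  exact ⟨h2, h1, h3.symm, h5, h4, h7, h6⟩

theorem crNum_eq [Finite V] (D : Drawing G) (hD : D.IsGood) :
    D.crNum = (Prod.snd '' D.crossings G.edgeSet G.edgeSet).ncard := by
  unfold Drawing.crNum Drawing.crBetween
  rw [Set.InjOn.ncard_image, Set.ncard_def, Nat.card_coe_set_eq, Set.ncard_def]
  rintro ⟨p, q⟩ hp ⟨p', q'⟩ hp' hq
  simp only at hq
  subst hq
  obtain ⟨e, f, h1, -, -, h2⟩ := hp
  obtain ⟨e', f', h1', -, -, h2'⟩ := hp'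
  simp only at h1 h1' h2 h2'
  rw [h1, Sym2.eq_iff] at h1'
  congr 1
  rcases h1' with ⟨rfl, rfl⟩ | ⟨rfl, rfl⟩
  · exact hD.cross_once _ _ h2 h2'
  · exact hD.cross_once _ _ h2 (isCrossing_symm h2')

end Topo

namespace Topo
open Rot Finset
variable {V : Type*} {G : SimpleGraph V}

theorem lowerA [Finite V] {D : Drawing G} (hD : D.IsGood) (A : Data D) {n : ℕ} (W : Fin (n + 1) → V)
    (B : Fin 5 → V) (hW : Function.Injective W) (hB : Function.Injective B)
    (hadj : ∀ X i, ¬ (X = 0 ∧ i = 0) → G.Adj (W X) (B i))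
    (ρ : Fin (n + 1) → Fin 5 → Fin 5 → ZMod 2) (ρ' : Fin 5 → Fin (n + 1) → Fin (n + 1) → ZMod 2)
    (cyc : ∀ x, Cyc (ρ x)) (cyc' : ∀ i, Cyc (ρ' i))
    (hρ : ∀ X i j, i < j → (X ≠ 0 ∨ i ≠ 0) → ρ X i j = A.rhos (W X) (B i) (B j))
    (hρ' : ∀ i X Y, X < Y → (X ≠ 0 ∨ i ≠ 0) → ρ' i X Y = A.rho (B i) (W X) (W Y)) :
    Comb.tgt (n + 1) ≤ 2 * ((D.crNum : ℤ) + ∑ y : Fin n, ∑ j : Fin 4,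
      ind (1 + ρ 0 0 j.succ + ρ y.succ 0 j.succ + ρ' 0 0 y.succ + ρ' j.succ 0 y.succ)) := by
  classical
  let Rh : Fin (n + 1) → Fin (n + 1) → Fin 5 → Fin 5 → ZMod 2 := fun X Y i j =>
    1 + ρ X i j + ρ Y i j + ρ' i X Y + ρ' j X Y
  let N : Fin (n + 1) → Fin (n + 1) → Fin 5 → Fin 5 → ZMod 2 := fun X Y i j =>
    if X = 0 ∧ i = 0 then 0 else if X = 0 ∧ j = 0 then Rh X Y j i
      else A.Mv (W X) (B i) (W Y) (B j)
  have hWB : ∀ X i, W X = B i → X = 0 ∧ i = 0 := by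
    intro X i h
    by_contra h'
    exact (hadj X i h').ne h
  have rel : ∀ x y i j, x < y → i < j →
      N x y i j + N x y j i = 1 + ρ x i j + ρ y i j + ρ' i x y + ρ' j x y := by
    intro x y i j hxy hij
    have hy : y ≠ 0 := (lt_of_le_of_lt (Fin.zero_le _) hxy).ne'
    have hj : j ≠ 0 := (lt_of_le_of_lt (Fin.zero_le _) hij).ne'
    by_cases h : x = 0 ∧ i = 0
    · simp only [N, h, hj, and_self, and_false, if_true, if_false, zero_add, Rh]
    · have h' : x ≠ 0 ∨ i ≠ 0 := by tauto
      have h1 : ¬ (x = 0 ∧ j = 0) := by tauto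
      simp only [N, if_neg h, if_neg h1]
      rw [hρ x i j hij h', hρ y i j hij (Or.inl hy), hρ' i x y hxy h', hρ' j x y hxy (Or.inr hj)]
      exact A.Mv_rel (hadj _ _ h) (hadj _ _ h1) (hadj _ _ (by tauto)) (hadj _ _ (by tauto))
        (hW.ne hxy.ne) (hB.ne hij.ne)
  let R := RS.ofHalf N ρ ρ' cyc cyc' rel
  have hb := Comb.bound R.good (n + 1) univ (by simp)
  refine hb.trans ?_
  have hc0 : ∀ x, R.c x x = 0 := fun x => by simp [RS.c]
  have hcs : ∀ x y, R.c x y = R.c y x := R.good.symm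
  rw [f2_half R.c hc0 hcs]
  refine mul_le_mul_of_nonneg_left ?_ (by norm_num)
  have hc : ∀ x y, x < y → R.c x y = ∑ i, ∑ j, if i = j then 0 else ind (N x y i j) := by
    intro x y h
    simp [RS.c, h.ne, R, RS.ofHalf, h]
  let Q : Finset (Fin (n + 1) × Fin (n + 1) × Fin 5 × Fin 5) := univ.filter fun q =>
    q.1 < q.2.1 ∧ q.2.2.1 ≠ q.2.2.2 ∧ (q.1 ≠ 0 ∨ (q.2.2.1 ≠ 0 ∧ q.2.2.2 ≠ 0)) ∧
      A.Mv (W q.1) (B q.2.2.1) (W q.2.1) (B q.2.2.2) ≠ 0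
  let F : Fin (n + 1) → Fin (n + 1) → Fin 5 → Fin 5 → ℤ := fun X Y i j =>
    if X = 0 ∧ Y ≠ 0 ∧ j = 0 ∧ i ≠ 0 then ind (Rh X Y j i) else 0
  have hterm : ∀ x y i j, (if x < y then (if i = j then 0 else ind (N x y i j)) else 0) =
      (if (x, y, i, j) ∈ Q then (1 : ℤ) else 0) + F x y i j := by
    intro x y i j
    simp only [Q, F, mem_filter, mem_univ, true_and]
    by_cases hxy : x < y
    · have hy : y ≠ 0 := (lt_of_le_of_lt (Fin.zero_le _) hxy).ne'
      by_cases hij : i = j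
      · subst hij; simp
      · simp only [hxy, hij, hy, N, ind, if_true, if_false, true_and, ne_eq, not_false_eq_true]
        by_cases hx : x = 0
        · by_cases hi : i = 0
          · have : j ≠ 0 := fun h => hij (hi.trans h.symm)
            simp [hx, hi, this]
          · by_cases hj : j = 0
            · simp [hx, hi, hj]
            · simp [hx, hi, hj]
        · simp [hx]
    · have h2 : ¬ (x = 0 ∧ y ≠ 0) := by
        rintro ⟨rfl, h⟩
        exact hxy (Fin.pos_of_ne_zero h)
      have h3 : ¬ (x = 0 ∧ y ≠ 0 ∧ j = 0 ∧ i ≠ 0) := by tauto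
      rw [if_neg hxy, if_neg h3]
      simp [hxy]
  have hsum : (∑ x, ∑ y, if x < y then R.c x y else 0) =
      (Q.card : ℤ) + ∑ x, ∑ y, ∑ i, ∑ j, F x y i j := by
    have e1 : (∑ x, ∑ y, if x < y then R.c x y else 0) =
        ∑ x, ∑ y, ∑ i, ∑ j, ((if (x, y, i, j) ∈ Q then (1 : ℤ) else 0) + F x y i j) := by
      refine sum_congr rfl fun x _ => sum_congr rfl fun y _ => ?_
      simp only [← hterm]
      by_cases h : x < y
      · simp only [if_pos h, hc x y h]
      · simp only [if_neg h, sum_const_zero]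
    rw [e1]
    simp only [sum_add_distrib]
    congr 1
    have e2 : (Q.card : ℤ) = ∑ q, if q ∈ Q then (1 : ℤ) else 0 := by simp
    rw [e2]
    simp only [Fintype.sum_prod_type]
  rw [hsum]
  refine add_le_add ?_ (le_of_eq ?_)
  · rw [crNum_eq D hD]
    norm_cast
    let φ : Fin (n + 1) × Fin (n + 1) × Fin 5 × Fin 5 → Sym2 (Sym2 V) := fun q =>
      s(s(W q.1, B q.2.2.1), s(W q.2.1, B q.2.2.2))
    rw [← Set.ncard_coe_finset]
    apply Set.ncard_le_ncard_of_injOn φ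
    · rintro ⟨x, y, i, j⟩ hq
      simp only [Q, coe_filter, mem_univ, true_and, Set.mem_ofPred_eq] at hq
      obtain ⟨hxy, hij, h1, h2⟩ := hq
      have hy : y ≠ 0 := (lt_of_le_of_lt (Fin.zero_le _) hxy).ne'
      have a1 := hadj x i (by tauto)
      have a2 := hadj y j (by tauto)
      obtain ⟨p, hp⟩ := A.cross_of a1 a2 (hW.ne hxy.ne) (hadj x j (by tauto)).ne
        (hadj y i (by tauto)).ne.symm (hB.ne hij) h2
      exact ⟨(p, φ (x, y, i, j)), ⟨_, _, rfl, a1, a2, hp⟩, rfl⟩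
    · rintro ⟨x, y, i, j⟩ hq ⟨x', y', i', j'⟩ hq' heq
      simp only [Q, coe_filter, mem_univ, true_and, Set.mem_ofPred_eq] at hq hq'
      obtain ⟨hxy, hij, h1, -⟩ := hq
      obtain ⟨hxy', hij', h1', -⟩ := hq'
      have hy : y ≠ 0 := (lt_of_le_of_lt (Fin.zero_le _) hxy).ne'
      have hy' : y' ≠ 0 := (lt_of_le_of_lt (Fin.zero_le _) hxy').ne'
      have E : ∀ X I X' I', s(W X, B I) = s(W X', B I') → ¬ (X = 0 ∧ I = 0) → X = X' ∧ I = I' := by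
        intro X I X' I' h h0
        rw [Sym2.eq_iff] at h
        rcases h with ⟨h, h'⟩ | ⟨h, h'⟩
        · exact ⟨hW h, hB h'⟩
        · exact absurd ⟨(hWB _ _ h).1, (hWB _ _ h'.symm).2⟩ h0
      simp only [φ] at heq
      rw [Sym2.eq_iff] at heq
      rcases heq with ⟨h, h'⟩ | ⟨h, h'⟩
      · obtain ⟨rfl, rfl⟩ := E _ _ _ _ h (by tauto)
        obtain ⟨rfl, rfl⟩ := E _ _ _ _ h' (by tauto)
        rfl
      · obtain ⟨rfl, rfl⟩ := E _ _ _ _ h (by tauto)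
        obtain ⟨rfl, rfl⟩ := E _ _ _ _ h' (by tauto)
        exact absurd hxy hxy'.not_gt
  · rw [Fin.sum_univ_succ]
    simp [F, Fin.sum_univ_succ, Rh]

end Topo


namespace Rot
open Finset

theorem Cyc.switch {α : Type*} {ρ ρ1 : α → α → ZMod 2} (h : Cyc ρ) (s : α → ZMod 2)
    (h1 : ∀ v w, v ≠ w → ρ1 v w = ρ v w + s v + s w) : Cyc ρ1 := by
  obtain ⟨r, z, hr, hz⟩ := h
  refine ⟨r, fun v => z v + s v, hr, fun v w hvw => ?_⟩
  rw [h1 v w hvw, hz v w hvw]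
  ring

/-- contribution of the artificial edge -/
def wt (p0 pa : ℤ) (ζ : ZMod 2) (rb : Fin 4 → ℤ) (t : ℤ) : ℤ :=
  ∑ j : Fin 4, ind (ζ + (if p0 < 2 * rb j then 1 else 0) + (if t < rb j then 1 else 0) +
    (if pa < 2 * t then 1 else 0))

theorem wt_facts (rb : Fin 4 → ℤ) (h01 : rb 0 < rb 1) (h12 : rb 1 < rb 2) (h23 : rb 2 < rb 3) (t : ℤ)
    (ht : ∀ j, t ≠ rb j) :
    ∃ q : ℤ, wt (2 * rb 1 + 1) (2 * rb 0 - 1) 1 rb t + wt (2 * rb 3 + 1) (2 * rb 2 - 1) 1 rb t = 2 ∧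
      wt (2 * rb 2 + 1) (2 * rb 0 - 1) 1 rb t + wt (2 * rb 0 + 1) (2 * rb 2 - 1) 0 rb t = 2 ∧
      wt (2 * rb 1 + 1) (2 * rb 0 - 1) 1 rb t + wt (2 * rb 2 + 1) (2 * rb 0 - 1) 1 rb t = 2 * q + 1 := by
  have t0 := ht 0
  have t1 := ht 1
  have t2 := ht 2
  have t3 := ht 3
  simp only [wt, Fin.sum_univ_four]
  generalize rb 0 = a at *
  generalize rb 1 = b at *
  generalize rb 2 = c at *
  generalize rb 3 = d at *
  have cases5 : t < a ∨ (a < t ∧ t < b) ∨ (b < t ∧ t < c) ∨ (c < t ∧ t < d) ∨ d < t := by omega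
  rcases cases5 with h | ⟨h, h'⟩ | ⟨h, h'⟩ | ⟨h, h'⟩ | h
  · refine ⟨1, ?_⟩
    simp (disch := omega) only [if_pos, if_neg]
    decide
  · refine ⟨1, ?_⟩
    simp (disch := omega) only [if_pos, if_neg]
    decide
  · refine ⟨0, ?_⟩
    simp (disch := omega) only [if_pos, if_neg]
    decide
  · refine ⟨0, ?_⟩
    simp (disch := omega) only [if_pos, if_neg]
    decide
  · refine ⟨1, ?_⟩
    simp (disch := omega) only [if_pos, if_neg]
    decide

end Rot

namespace Topo
open Rot Finset
variable {V : Type*} {G : SimpleGraph V}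

theorem lowerC [Finite V] {D : Drawing G} (hD : D.IsGood) (A : Data D) {n : ℕ} (a : V) (b : Fin 4 → V)
    (c : Fin n → V) (hb : Function.Injective b) (hc : Function.Injective c)
    (ab : ∀ i, G.Adj a (b i)) (ac : ∀ x, G.Adj a (c x)) (cb : ∀ x i, G.Adj (c x) (b i))
    (rb : Fin 4 → ℤ) (zb : Fin 4 → ZMod 2) (rc : Fin n → ℤ) (zc : Fin n → ZMod 2)
    (rbi : Function.Injective rb) (rci : Function.Injective rc)
    (hbb : ∀ i j, i ≠ j → A.rho a (b i) (b j) = zb i + zb j + if rb i < rb j then 1 else 0)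
    (hcc : ∀ i j, i ≠ j → A.rho a (c i) (c j) = zc i + zc j + if rc i < rc j then 1 else 0)
    (hcb : ∀ x i, A.rho a (c x) (b i) = zc x + zb i + if rc x < rb i then 1 else 0)
    (p0 pa : ℤ) (ζ : ZMod 2) (h0 : p0 % 2 = 1) (ha : pa % 2 = 1) :
    Comb.tgt (n + 1) ≤ 2 * ((D.crNum : ℤ) + ∑ y : Fin n, wt p0 pa ζ rb (rc y)) := by
  have hBi : Function.Injective (Fin.cons a b : Fin 5 → V) := by
    rw [Fin.cons_injective_iff]
    exact ⟨fun ⟨i, hi⟩ => (ab i).ne hi.symm, hb⟩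
  have hWi : Function.Injective (Fin.cons a c : Fin (n + 1) → V) := by
    rw [Fin.cons_injective_iff]
    exact ⟨fun ⟨i, hi⟩ => (ac i).ne hi.symm, hc⟩
  let ρ0 : Fin 5 → Fin 5 → ZMod 2 := fun i j =>
    (Fin.cons 0 (fun i => zb i + A.o a (b i)) : Fin 5 → ZMod 2) i +
    (Fin.cons 0 (fun i => zb i + A.o a (b i)) : Fin 5 → ZMod 2) j +
    if (Fin.cons p0 (fun i => 2 * rb i) : Fin 5 → ℤ) i < (Fin.cons p0 (fun i => 2 * rb i) : Fin 5 → ℤ) j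
      then 1 else 0
  let ρ : Fin (n + 1) → Fin 5 → Fin 5 → ZMod 2 :=
    Fin.cons ρ0 (fun x i j => A.rhos (c x) ((Fin.cons a b : Fin 5 → V) i) ((Fin.cons a b : Fin 5 → V) j))
  let ρ'0 : Fin (n + 1) → Fin (n + 1) → ZMod 2 := fun i j =>
    (Fin.cons ζ zc : Fin (n + 1) → ZMod 2) i +
    (Fin.cons ζ zc : Fin (n + 1) → ZMod 2) j +
    if (Fin.cons pa (fun i => 2 * rc i) : Fin (n + 1) → ℤ) i <
      (Fin.cons pa (fun i => 2 * rc i) : Fin (n + 1) → ℤ) j then 1 else 0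
  let ρ' : Fin 5 → Fin (n + 1) → Fin (n + 1) → ZMod 2 :=
    Fin.cons ρ'0 (fun k i j => A.rho (b k) ((Fin.cons a c : Fin (n + 1) → V) i)
      ((Fin.cons a c : Fin (n + 1) → V) j))
  have key := lowerA hD A (Fin.cons a c : Fin (n + 1) → V) (Fin.cons a b : Fin 5 → V) hWi hBi
    (by
      intro X i h
      rcases Fin.eq_zero_or_eq_succ X with rfl | ⟨x, rfl⟩
      · rcases Fin.eq_zero_or_eq_succ i with rfl | ⟨i, rfl⟩
        · exact absurd ⟨rfl, rfl⟩ h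
        · exact ab i
      · rcases Fin.eq_zero_or_eq_succ i with rfl | ⟨i, rfl⟩
        · exact (ac x).symm
        · exact cb x i) ρ ρ' ?_ ?_ ?_ ?_
  · refine key.trans (le_of_eq ?_)
    congr 2
    refine sum_congr rfl fun y _ => ?_
    unfold wt
    refine sum_congr rfl fun j _ => ?_
    congr 1
    simp only [ρ, ρ', ρ0, ρ'0, Fin.cons_zero, Fin.cons_succ]
    have e1 : A.rhos (c y) a (b j) + A.rho (b j) a (c y) = A.o a (b j) + 1 + A.rho a (c y) (b j) := by
      unfold Data.rhos
      simp only [Data.rho_eq]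
      rw [A.o_anti (ac y).ne, A.kap_symm (cb y j) (ac y).ne (ab j).ne,
        A.kap_symm (ac y) (ab j).ne.symm (cb y j).ne.symm, A.kap_symm (ab j) (ac y).ne.symm (cb y j).ne]
      linear_combination (A.kap (c y) (b j) a + A.o a (c y)) * two0
    rw [hcb] at e1
    linear_combination e1 + (1 + zc y + zb j + A.o a (b j)) * two0
  · intro x
    refine Fin.cases ?_ (fun x => ?_) x
    · refine ⟨(Fin.cons p0 (fun i => 2 * rb i) : Fin 5 → ℤ),
        (Fin.cons 0 (fun i => zb i + A.o a (b i)) : Fin 5 → ZMod 2), ?_, fun v w _ => ?_⟩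
      · rw [Fin.cons_injective_iff]
        refine ⟨?_, fun i j h => rbi (by simpa using h)⟩
        rintro ⟨i, hi⟩
        simp only at hi
        omega
      · simp only [ρ, ρ0, Fin.cons_zero]
    · simp only [ρ, Fin.cons_succ]
      refine Cyc.switch (A.cyc_rho (c x) (Fin.cons a b : Fin 5 → V) hBi ?_)
        (fun i => A.o (c x) ((Fin.cons a b : Fin 5 → V) i)) (fun v w _ => rfl)
      intro i
      refine Fin.cases ?_ (fun i => ?_) i
      · exact (ac x).symm
      · exact cb x i
  · intro i
    refine Fin.cases ?_ (fun i => ?_) i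
    · refine ⟨(Fin.cons pa (fun i => 2 * rc i) : Fin (n + 1) → ℤ),
        (Fin.cons ζ zc : Fin (n + 1) → ZMod 2), ?_, fun v w _ => ?_⟩
      · rw [Fin.cons_injective_iff]
        refine ⟨?_, fun i j h => rci (by simpa using h)⟩
        rintro ⟨i, hi⟩
        simp only at hi
        omega
      · simp only [ρ', ρ'0, Fin.cons_zero]
    · simp only [ρ', Fin.cons_succ]
      refine A.cyc_rho (b i) (Fin.cons a c : Fin (n + 1) → V) hWi ?_
      intro x
      refine Fin.cases ?_ (fun x => ?_) x
      · exact (ab i).symm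
      · exact (cb x i).symm
  · intro X i j hij h
    have hj : j ≠ 0 := (lt_of_le_of_lt (Fin.zero_le _) hij).ne'
    obtain ⟨j, rfl⟩ := Fin.exists_succ_eq.mpr hj
    rcases Fin.eq_zero_or_eq_succ X with rfl | ⟨x, rfl⟩
    · obtain ⟨i, rfl⟩ := Fin.exists_succ_eq.mpr (by tauto : i ≠ 0)
      have hne : i ≠ j := fun h => hij.ne (by rw [h])
      simp only [ρ, ρ0, Fin.cons_zero, Fin.cons_succ]
      unfold Data.rhos
      rw [hbb i j hne]
      have : (2 * rb i < 2 * rb j) = (rb i < rb j) := by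
        apply propext; constructor <;> intro <;> omega
      simp only [this]
      ring
    · simp only [ρ, Fin.cons_succ]
  · intro i X Y hij h
    have hj : Y ≠ 0 := (lt_of_le_of_lt (Fin.zero_le _) hij).ne'
    obtain ⟨y, rfl⟩ := Fin.exists_succ_eq.mpr hj
    rcases Fin.eq_zero_or_eq_succ i with rfl | ⟨i, rfl⟩
    · obtain ⟨x, rfl⟩ := Fin.exists_succ_eq.mpr (by tauto : X ≠ 0)
      have hne : x ≠ y := fun h => hij.ne (by rw [h])
      simp only [ρ', ρ'0, Fin.cons_zero, Fin.cons_succ]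
      rw [hcc x y hne]
      have : (2 * rc x < 2 * rc y) = (rc x < rc y) := by
        apply propext; constructor <;> intro <;> omega
      simp only [this]
    · simp only [ρ', Fin.cons_succ]

theorem tgt_Z (n : ℕ) : Comb.tgt (n + 1) = 2 * (Z 5 (n + 1) : ℤ) := by
  unfold Comb.tgt Z
  push_cast
  ring

theorem lowerD [Finite V] {D : Drawing G} (hD : D.IsGood) {n : ℕ} (a : V) (b : Fin 4 → V)
    (c : Fin n → V) (hb : Function.Injective b) (hc : Function.Injective c)
    (ab : ∀ i, G.Adj a (b i)) (ac : ∀ x, G.Adj a (c x)) (cb : ∀ x i, G.Adj (c x) (b i)) :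
    (Z 5 (n + 1) : ℤ) - 2 * ((n / 2 : ℕ) : ℤ) ≤ D.crNum := by
  obtain ⟨A⟩ := exists_data D hD
  have hfi : Function.Injective (Sum.elim b c) := by
    rintro (i | x) (j | y) h
    · exact congrArg _ (hb h)
    · exact absurd h (cb y i).ne.symm
    · exact absurd h (cb x j).ne
    · exact congrArg _ (hc h)
  obtain ⟨r, z, hr, hz⟩ := A.cyc_rho a (Sum.elim b c) hfi (by rintro (i | x); exacts [ab i, ac x])
  let σ := Tuple.sort (fun i => r (Sum.inl i))
  let rb : Fin 4 → ℤ := fun i => r (Sum.inl (σ i))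
  have hrbm : Monotone rb := Tuple.monotone_sort (fun i => r (Sum.inl i))
  have rbi : Function.Injective rb := fun i j h => σ.injective (Sum.inl_injective (hr h))
  have hrbs : StrictMono rb := hrbm.strictMono_of_injective rbi
  have rci : Function.Injective (fun x => r (Sum.inr x)) := fun i j h => Sum.inr_injective (hr h)
  have L := lowerC hD A a (b ∘ σ) c (hb.comp σ.injective) hc (fun i => ab _) ac (fun x i => cb _ _)
    rb (fun i => z (Sum.inl (σ i))) (fun x => r (Sum.inr x)) (fun x => z (Sum.inr x)) rbi rci
    (fun i j h => hz (Sum.inl (σ i)) (Sum.inl (σ j)) (fun h' => h (σ.injective (Sum.inl_injective h'))))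
    (fun i j h => hz (Sum.inr i) (Sum.inr j) (fun h' => h (Sum.inr_injective h')))
    (fun x i => hz (Sum.inr x) (Sum.inl (σ i)) (by simp))
  rw [tgt_Z] at L
  have L1 := L (2 * rb 1 + 1) (2 * rb 0 - 1) 1 (by omega) (by omega)
  have L2 := L (2 * rb 3 + 1) (2 * rb 2 - 1) 1 (by omega) (by omega)
  have L3 := L (2 * rb 2 + 1) (2 * rb 0 - 1) 1 (by omega) (by omega)
  have L4 := L (2 * rb 0 + 1) (2 * rb 2 - 1) 0 (by omega) (by omega)
  have F := fun x : Fin n => wt_facts rb (hrbs (by decide)) (hrbs (by decide)) (hrbs (by decide))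
    (r (Sum.inr x)) (fun j h => by simpa using hr h)
  choose q f1 f2 f3 using F
  have s1 := sum_congr (rfl : (univ : Finset (Fin n)) = univ) (fun x _ => f1 x)
  have s2 := sum_congr (rfl : (univ : Finset (Fin n)) = univ) (fun x _ => f2 x)
  have s3 := sum_congr (rfl : (univ : Finset (Fin n)) = univ) (fun x _ => f3 x)
  simp only [sum_add_distrib, ← mul_sum, sum_const, card_univ, Fintype.card_fin, nsmul_eq_mul] at s1 s2 s3
  push_cast
  omega

end Topo


namespace Up
open Finset

/-- heights of the five axis vertices -/
noncomputable def H : Fin 5 → ℝ := ![-1, 1, 2, -2, -3]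
/-- horizontal offsets of the five axis vertices -/
noncomputable def X : Fin 5 → ℝ := ![0, 1 / 10, 0, 1 / 10, 0]
noncomputable def q (j : ℕ) : ℝ := (-2) ^ j

def near : Fin 4 → Fin 5 := ![1, 0, 0, 3]
def far : Fin 4 → Fin 5 := ![2, 3, 4, 4]

theorem X_bd (i : Fin 5) : 0 ≤ X i ∧ X i ≤ 1 / 10 := by
  fin_cases i <;> simp [X] <;> norm_num

theorem q_even {j : ℕ} (h : j % 2 = 0) : 1 ≤ q j := by
  obtain ⟨k, rfl⟩ : ∃ k, j = 2 * k := ⟨j / 2, by omega⟩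
  unfold q
  rw [pow_mul]
  exact one_le_pow₀ (by norm_num)

theorem q_odd {j : ℕ} (h : j % 2 = 1) : q j ≤ -1 := by
  obtain ⟨k, rfl⟩ : ∃ k, j = 2 * k + 1 := ⟨j / 2, by omega⟩
  have := q_even (j := 2 * k) (by omega)
  unfold q at *
  rw [pow_succ]
  linarith

theorem q_abs (j : ℕ) : 1 ≤ q j ∨ q j ≤ -1 := by
  rcases Nat.mod_two_eq_zero_or_one j with h | h
  · exact Or.inl (q_even h)
  · exact Or.inr (q_odd h)

theorem q_ratio {j l : ℕ} (h : j % 2 = l % 2) (hjl : j < l) : ∃ r : ℝ, 4 ≤ r ∧ q l = r * q j := by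
  obtain ⟨k, rfl⟩ : ∃ k, l = j + 2 * (k + 1) := ⟨(l - j) / 2 - 1, by omega⟩
  refine ⟨4 ^ (k + 1), ?_, ?_⟩
  · have : (1 : ℝ) ≤ 4 ^ k := one_le_pow₀ (by norm_num)
    rw [pow_succ]; linarith
  · unfold q
    rw [pow_add, pow_mul]; norm_num; ring

theorem q_cases (j l : ℕ) : (l < j ∧ l % 2 = j % 2) ∨ (1 ≤ q j ∧ q l ≤ -1) ∨ (q j ≤ -1 ∧ 1 ≤ q l) ∨
    (1 ≤ q j ∧ 4 * q j ≤ q l) ∨ (q j ≤ -1 ∧ q l ≤ 4 * q j) ∨ j = l := by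
  rcases Nat.mod_two_eq_zero_or_one j with h | h <;> rcases Nat.mod_two_eq_zero_or_one l with h' | h'
  · rcases lt_trichotomy j l with g | g | g
    · obtain ⟨r, hr, e⟩ := q_ratio (by omega) g
      have := q_even h
      refine Or.inr (Or.inr (Or.inr (Or.inl ⟨this, ?_⟩)))
      rw [e]; nlinarith
    · simp [g]
    · exact Or.inl ⟨g, by omega⟩
  · exact Or.inr (Or.inl ⟨q_even h, q_odd h'⟩)
  · exact Or.inr (Or.inr (Or.inl ⟨q_odd h, q_even h'⟩))
  · rcases lt_trichotomy j l with g | g | g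
    · obtain ⟨r, hr, e⟩ := q_ratio (by omega) g
      have := q_odd h
      refine Or.inr (Or.inr (Or.inr (Or.inr (Or.inl ⟨this, ?_⟩))))
      rw [e]; nlinarith
    · simp [g]
    · exact Or.inl ⟨g, by omega⟩

theorem q_inj {j l : ℕ} (h : q j = q l) : j = l := by
  rcases q_cases j l with g | g | g | g | g | g
  · obtain ⟨r, hr, e⟩ := q_ratio g.2 g.1
    rcases q_abs l with a | a <;> nlinarith
  all_goals first | exact g | (exfalso; linarith [g.1, g.2])

/-- main estimate: the edge closer to the axis goes further out -/
theorem nf {j l : ℕ} {t s x x' : ℝ} (ht : 0 < t) (ht1 : t ≤ 1) (hs : s ≤ 2 / 3 * t) (hs0 : 0 < s)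
    (hx : 0 ≤ x ∧ x ≤ 1 / 10) (hx' : 0 ≤ x' ∧ x' ≤ 1 / 10)
    (e : (1 - t) * q j + t * x = (1 - s) * q l + s * x') : l < j ∧ l % 2 = j % 2 := by
  have a1 : 0 ≤ t * x := mul_nonneg ht.le hx.1
  have a2 : 0 ≤ s * x' := mul_nonneg hs0.le hx'.1
  have a3 : t * x ≤ t * (1 / 10) := mul_le_mul_of_nonneg_left hx.2 ht.le
  have a4 : s * x' ≤ s * (1 / 10) := mul_le_mul_of_nonneg_left hx'.2 hs0.le
  rcases q_cases j l with g | g | g | g | g | g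
  · exact g
  · exfalso; nlinarith [mul_nonneg (sub_nonneg.2 ht1) (by linarith [g.1] : 0 ≤ q j - 1),
      mul_nonneg (by linarith : 0 ≤ 1 - s) (by linarith [g.2] : 0 ≤ -1 - q l)]
  · exfalso; nlinarith [mul_nonneg (sub_nonneg.2 ht1) (by linarith [g.1] : 0 ≤ -1 - q j),
      mul_nonneg (by linarith : 0 ≤ 1 - s) (by linarith [g.2] : 0 ≤ q l - 1)]
  · exfalso
    have := mul_nonneg (by linarith : 0 ≤ 1 - s) (by linarith [g.2] : 0 ≤ q l - 4 * q j)
    have := mul_nonneg ht.le (by linarith [g.1] : 0 ≤ q j - 1)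
    have := mul_nonneg (by linarith : 0 ≤ 2 / 3 - s) (by linarith [g.1] : 0 ≤ q j - 1)
    nlinarith [g.1]
  · exfalso
    have := mul_nonneg (by linarith : 0 ≤ 1 - s) (by linarith [g.2] : 0 ≤ 4 * q j - q l)
    have := mul_nonneg ht.le (by linarith [g.1] : 0 ≤ -1 - q j)
    have := mul_nonneg (by linarith : 0 ≤ 2 / 3 - s) (by linarith [g.1] : 0 ≤ -1 - q j)
    nlinarith [g.1]
  · exfalso
    subst g
    rcases q_abs j with a | a
    · have := mul_nonneg (by linarith : 0 ≤ t - s) (by linarith : 0 ≤ q j - 1)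
      nlinarith
    · have := mul_nonneg (by linarith : 0 ≤ t - s) (by linarith : 0 ≤ -1 - q j)
      nlinarith

theorem hs {i k : Fin 5} {t s : ℝ} (ht : 0 < t) (hs : 0 < s) (e : t * H i = s * H k) :
    i = k ∨ (∃ m, i = near m ∧ k = far m ∧ s ≤ 2 / 3 * t) ∨
      (∃ m, k = near m ∧ i = far m ∧ t ≤ 2 / 3 * s) := by
  fin_cases i <;> fin_cases k <;> simp [H] at e <;>
    first
    | exact Or.inl rfl
    | (exfalso; linarith)
    | exact Or.inr (Or.inl ⟨0, rfl, rfl, by linarith⟩)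
    | exact Or.inr (Or.inl ⟨1, rfl, rfl, by linarith⟩)
    | exact Or.inr (Or.inl ⟨2, rfl, rfl, by linarith⟩)
    | exact Or.inr (Or.inl ⟨3, rfl, rfl, by linarith⟩)
    | exact Or.inr (Or.inr ⟨0, rfl, rfl, by linarith⟩)
    | exact Or.inr (Or.inr ⟨1, rfl, rfl, by linarith⟩)
    | exact Or.inr (Or.inr ⟨2, rfl, rfl, by linarith⟩)
    | exact Or.inr (Or.inr ⟨3, rfl, rfl, by linarith⟩)

/-- crossings of axis edges with fan edges -/
theorem ac {i : Fin 4} {k : Fin 5} {l : ℕ} {t s : ℝ} (ht : 0 < t) (ht1 : t < 1) (hs : 0 < s) (hs1 : s < 1)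
    (e1 : t * X i.succ = (1 - s) * q l + s * X k) (e2 : (1 - t) * (-1) + t * H i.succ = s * H k) :
    ((i = 1 ∧ k = 1) ∨ (i = 3 ∧ k = 3)) ∧ l % 2 = 1 := by
  rcases Nat.mod_two_eq_zero_or_one l with h | h
  · exfalso
    have := mul_nonneg (sub_nonneg.2 hs1.le) (sub_nonneg.2 (q_even h))
    generalize q l = Q at *
    have : (1 - s) ≤ (1 - s) * Q := by linarith
    generalize (1 - s) * Q = A at *
    fin_cases i <;> fin_cases k <;> simp [H, X] at e1 e2 <;> linarith
  · refine ⟨?_, h⟩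
    have := mul_nonneg (sub_nonneg.2 hs1.le) (sub_nonneg.2 (q_odd h))
    generalize q l = Q at *
    have : (1 - s) * Q ≤ - (1 - s) := by linarith
    generalize (1 - s) * Q = A at *
    fin_cases i <;> fin_cases k <;> simp [H, X] at e1 e2 <;>
      first
      | exact Or.inl ⟨rfl, rfl⟩
      | exact Or.inr ⟨rfl, rfl⟩
      | (exfalso; linarith)

theorem aa {i k : Fin 4} {t s : ℝ} (ht : 0 < t) (hs : 0 < s)
    (e1 : t * X i.succ = s * X k.succ)
    (e2 : (1 - t) * (-1) + t * H i.succ = (1 - s) * (-1) + s * H k.succ) : i = k := by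
  fin_cases i <;> fin_cases k <;> simp [H, X] at e1 e2 <;>
      first
      | rfl
      | (exfalso; linarith)

theorem av2 {i : Fin 4} {k : Fin 5} {t : ℝ} (ht : 0 ≤ t) (ht1 : t ≤ 1) (e1 : t * X i.succ = X k)
    (e2 : (1 - t) * (-1) + t * H i.succ = H k) : k = 0 ∨ k = i.succ := by
  fin_cases i <;> fin_cases k <;> simp [H, X] at e1 e2 <;>
      first
      | exact Or.inl rfl
      | exact Or.inr rfl
      | (exfalso; linarith)

theorem av1 {i k : Fin 5} {j : ℕ} {t : ℝ} (ht : 0 ≤ t)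
    (e1 : (1 - t) * q j + t * X i = X k) (e2 : t * H i = H k) (ht1 : t ≤ 1) : i = k := by
  have hk : H k ≠ 0 := by fin_cases k <;> simp [H]
  have ht0 : 0 < t := by
    rcases ht.eq_or_lt with h | h
    · subst h; simp at e2; exact absurd e2.symm hk
    · exact h
  rcases hs ht0 one_pos (by linarith : t * H i = 1 * H k) with h | ⟨m, -, -, h⟩ | ⟨m, -, -, h⟩
  · exact h
  · exfalso; linarith
  · exfalso
    have a := X_bd i
    have b := X_bd k
    have c := mul_nonneg ht a.1
    have d := mul_le_mul_of_nonneg_left a.2 ht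
    rcases q_abs j with g | g
    · have := mul_nonneg (by linarith : 0 ≤ 1 - t) (sub_nonneg.2 g)
      linarith
    · have := mul_nonneg (by linarith : 0 ≤ 1 - t) (sub_nonneg.2 g)
      linarith

theorem y34 {j l : ℕ} {t s : ℝ} (ht : 0 < t) (ht1 : t < 1) (hs1 : 0 < s) (e2 : t * H 3 = s * H 4)
    (e1 : (1 - t) * q j + t * X 3 = (1 - s) * q l + s * X 4) : t * H 3 < -1 := by
  have h := nf ht ht1.le (by simp [H] at e2; linarith) hs1 (X_bd 3) (X_bd 4) e1
  obtain ⟨r, hr, e⟩ := q_ratio h.2 h.1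
  simp [H, X] at *
  rw [e] at e1
  by_contra hc
  push Not at hc
  rcases q_abs l with g | g
  · have := mul_nonneg (by linarith : 0 ≤ 1 - t) (mul_nonneg (sub_nonneg.2 hr) (by linarith : 0 ≤ q l))
    nlinarith
  · have := mul_nonneg (by linarith : 0 ≤ 1 - t) (mul_nonneg (sub_nonneg.2 hr) (by linarith : 0 ≤ - q l))
    nlinarith

end Up


namespace Up
open Finset

/-- A tripartite-like configuration. -/
structure Conf {V : Type*} (G : SimpleGraph V) (n : ℕ) where
  P : Fin 5 → V
  C : Fin n → V
  Pi : Function.Injective P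
  Ci : Function.Injective C
  PC : ∀ k j, P k ≠ C j
  all : ∀ v, (∃ k, v = P k) ∨ ∃ j, v = C j
  adj : ∀ u v, G.Adj u v → (∃ i : Fin 4, u = P 0 ∧ v = P i.succ) ∨ (∃ i : Fin 4, v = P 0 ∧ u = P i.succ) ∨
    (∃ j k, u = C j ∧ v = P k) ∨ (∃ j k, v = C j ∧ u = P k)

namespace Conf
variable {V : Type*} {G : SimpleGraph V} {n : ℕ} (K : Conf G n)

theorem exists_pos : ∃ pos : V → ℝ × ℝ, (∀ k, pos (K.P k) = (X k, H k)) ∧ ∀ j, pos (K.C j) = (q j, 0) := by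
  have hb : Function.Bijective (Sum.elim K.P K.C) := by
    constructor
    · rintro (i | x) (j | y) h
      · exact congrArg _ (K.Pi h)
      · exact absurd h (K.PC _ _)
      · exact absurd h.symm (K.PC _ _)
      · exact congrArg _ (K.Ci h)
    · intro v
      rcases K.all v with ⟨k, rfl⟩ | ⟨j, rfl⟩
      · exact ⟨Sum.inl k, rfl⟩
      · exact ⟨Sum.inr j, rfl⟩
  let e := Equiv.ofBijective _ hb
  refine ⟨fun v => Sum.elim (fun k => (X k, H k)) (fun j : Fin n => (q j, 0)) (e.symm v), ?_, ?_⟩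
  · intro k
    have : e.symm (K.P k) = Sum.inl k := by rw [Equiv.symm_apply_eq]; rfl
    simp [this]
  · intro k
    have : e.symm (K.C k) = Sum.inr k := by rw [Equiv.symm_apply_eq]; rfl
    simp [this]

noncomputable def pos : V → ℝ × ℝ := K.exists_pos.choose
theorem pos_P (k : Fin 5) : K.pos (K.P k) = (X k, H k) := K.exists_pos.choose_spec.1 k
theorem pos_C (j : Fin n) : K.pos (K.C j) = (q j, 0) := K.exists_pos.choose_spec.2 j

/-- straight segments -/
noncomputable def seg (u v : V) (t : ℝ) : ℝ × ℝ :=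
  ((1 - t) * (K.pos u).1 + t * (K.pos v).1, (1 - t) * (K.pos u).2 + t * (K.pos v).2)

theorem seg_symm (u v : V) (t : ℝ) : K.seg v u t = K.seg u v (1 - t) := by
  simp only [seg, Prod.mk.injEq]; constructor <;> ring

theorem H_ne (k : Fin 5) : H k ≠ 0 := by fin_cases k <;> simp [H]

theorem H_inj {i k : Fin 5} (h : H i = H k) : i = k := by
  fin_cases i <;> fin_cases k <;> first | rfl | (exfalso; simp [H] at h; done) | (exfalso; simp [H] at h; linarith)

theorem pos_inj : Function.Injective K.pos := by
  intro u v h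
  rcases K.all u with ⟨k, rfl⟩ | ⟨j, rfl⟩ <;> rcases K.all v with ⟨k', rfl⟩ | ⟨j', rfl⟩ <;>
    simp only [pos_P, pos_C, Prod.mk.injEq] at h
  · rw [H_inj h.2]
  · exact absurd h.2 (H_ne _)
  · exact absurd h.2.symm (H_ne _)
  · rw [Fin.ext (q_inj h.1)]

theorem avC (j : Fin n) (k : Fin 5) (w : V) (h1 : w ≠ K.C j) (h2 : w ≠ K.P k) (t : ℝ) (ht : t ∈ Set.Icc (0 : ℝ) 1) :
    K.seg (K.C j) (K.P k) t ≠ K.pos w := by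
  intro e
  rcases K.all w with ⟨k', rfl⟩ | ⟨j', rfl⟩ <;>
    simp only [seg, pos_P, pos_C, Prod.mk.injEq, mul_zero, zero_add] at e
  · exact h2 (by rw [av1 ht.1 e.1 e.2 ht.2])
  · have : t = 0 := by
      rcases mul_eq_zero.1 e.2 with h | h
      · exact h
      · exact absurd h (H_ne _)
    subst this
    simp at e
    exact h1 (by rw [Fin.ext (q_inj e.symm)])

theorem avA (i : Fin 4) (w : V) (h1 : w ≠ K.P 0) (h2 : w ≠ K.P i.succ) (t : ℝ) (ht : t ∈ Set.Icc (0 : ℝ) 1) :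
    K.seg (K.P 0) (K.P i.succ) t ≠ K.pos w := by
  intro e
  have hX : X 0 = 0 := rfl
  have hH : H 0 = -1 := rfl
  rcases K.all w with ⟨k', rfl⟩ | ⟨j', rfl⟩ <;>
    simp only [seg, pos_P, pos_C, Prod.mk.injEq, hX, hH, mul_zero, zero_add] at e
  · rcases av2 ht.1 ht.2 e.1 e.2 with h | h
    · exact h1 (by rw [h])
    · exact h2 (by rw [h])
  · have b := X_bd i.succ
    have c := mul_nonneg ht.1 b.1
    have d := mul_le_mul_of_nonneg_right ht.2 b.1
    rcases q_abs j' with g | g <;> linarith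

noncomputable def drawing : Drawing G where
  pos := K.pos
  pos_inj := K.pos_inj
  arc := K.seg
  arc_cont := by
    intro a b _
    unfold seg
    fun_prop
  arc_zero := by intro a b _; simp [seg]
  arc_one := by intro a b _; simp [seg]
  arc_symm := by intro a b _ t; exact K.seg_symm a b t
  arc_avoid := by
    rintro a b hab c ha hb ⟨t, ht, e⟩
    rcases K.adj a b hab with ⟨i, rfl, rfl⟩ | ⟨i, rfl, rfl⟩ | ⟨j, k, rfl, rfl⟩ | ⟨j, k, rfl, rfl⟩
    · exact K.avA i c ha hb t ht e
    · rw [seg_symm] at e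
      exact K.avA i c hb ha (1 - t) ⟨by linarith [ht.2], by linarith [ht.1]⟩ e
    · exact K.avC j k c ha hb t ht e
    · rw [seg_symm] at e
      exact K.avC j k c hb ha (1 - t) ⟨by linarith [ht.2], by linarith [ht.1]⟩ e

theorem edge_cases {e : Sym2 V} (he : e ∈ G.edgeSet) :
    (∃ i : Fin 4, e = s(K.P 0, K.P i.succ)) ∨ ∃ j k, e = s(K.C j, K.P k) := by
  induction e using Sym2.ind with
  | _ a b =>
    rcases K.adj a b he with ⟨i, rfl, rfl⟩ | ⟨i, rfl, rfl⟩ | ⟨j, k, rfl, rfl⟩ | ⟨j, k, rfl, rfl⟩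
    · exact Or.inl ⟨i, rfl⟩
    · exact Or.inl ⟨i, Sym2.eq_swap⟩
    · exact Or.inr ⟨j, k, rfl⟩
    · exact Or.inr ⟨j, k, Sym2.eq_swap⟩

theorem point {u v : V} {p : ℝ × ℝ} (h : p ∈ K.drawing.edgePoints s(u, v)) (h' : p ∉ K.drawing.ends s(u, v)) :
    ∃ t, 0 < t ∧ t < 1 ∧ p = K.seg u v t := by
  have key : ∃ t ∈ Set.Icc (0 : ℝ) 1, p = K.seg u v t := by
    obtain ⟨a, b, e, -, t, ht, rfl⟩ := h
    rw [Sym2.eq_iff] at e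
    rcases e with ⟨rfl, rfl⟩ | ⟨rfl, rfl⟩
    · exact ⟨t, ht, rfl⟩
    · exact ⟨1 - t, ⟨by linarith [ht.2], by linarith [ht.1]⟩, K.seg_symm _ _ t⟩
  obtain ⟨t, ht, e⟩ := key
  refine ⟨t, lt_of_le_of_ne ht.1 ?_, lt_of_le_of_ne ht.2 ?_, e⟩
  · rintro rfl
    exact h' ⟨u, by simp, by rw [e]; simp [seg, drawing]⟩
  · rintro rfl
    exact h' ⟨v, by simp, by rw [e]; simp [seg, drawing]⟩

theorem crC {j : Fin n} {k : Fin 5} {p : ℝ × ℝ} (h : p ∈ K.drawing.edgePoints s(K.C j, K.P k))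
    (h' : p ∉ K.drawing.ends s(K.C j, K.P k)) :
    ∃ t, 0 < t ∧ t < 1 ∧ p.1 = (1 - t) * q j + t * X k ∧ p.2 = t * H k := by
  obtain ⟨t, h1, h2, rfl⟩ := K.point h h'
  exact ⟨t, h1, h2, by simp [seg, pos_P, pos_C], by simp [seg, pos_P, pos_C]⟩

theorem crA {i : Fin 4} {p : ℝ × ℝ} (h : p ∈ K.drawing.edgePoints s(K.P 0, K.P i.succ))
    (h' : p ∉ K.drawing.ends s(K.P 0, K.P i.succ)) :
    ∃ t, 0 < t ∧ t < 1 ∧ p.1 = t * X i.succ ∧ p.2 = (1 - t) * (-1) + t * H i.succ := by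
  have hX : X 0 = 0 := rfl
  have hH : H 0 = -1 := rfl
  obtain ⟨t, h1, h2, rfl⟩ := K.point h h'
  exact ⟨t, h1, h2, by simp [seg, pos_P, hX], by simp [seg, pos_P, hH]⟩

/-- the combinatorial type of a crossing of two fan edges -/
def NF (j l : ℕ) (i k : Fin 5) : Prop := ∃ m, i = near m ∧ k = far m ∧ l < j ∧ l % 2 = j % 2

theorem lcc {j l : Fin n} {i k : Fin 5} {p : ℝ × ℝ}
    (h : K.drawing.IsCrossing s(K.C j, K.P i) s(K.C l, K.P k) p) :
    (NF j l i k ∨ NF l j k i) ∧ (i = 3 → k = 4 → p.2 < -1) ∧ (i = 4 → k = 3 → p.2 < -1) ∧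
      (i = 0 → -1 < p.2) ∧ (k = 0 → -1 < p.2) := by
  obtain ⟨-, -, hne, h1, h2, h1', h2'⟩ := h
  obtain ⟨t, t0, t1, tx, ty⟩ := K.crC h1 h1'
  obtain ⟨s, s0, s1, sx, sy⟩ := K.crC h2 h2'
  have hH : H 0 = -1 := rfl
  refine ⟨?_, ?_, ?_, ?_, ?_⟩
  · rcases hs t0 s0 (ty.symm.trans sy) with rfl | ⟨m, a, b, c⟩ | ⟨m, a, b, c⟩
    · exfalso
      have hts : t = s := mul_right_cancel₀ (H_ne i) (ty.symm.trans sy)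
      subst hts
      have : (1 - t) * q j = (1 - t) * q l := by linarith
      have := mul_left_cancel₀ (by linarith : (1 - t) ≠ 0) this
      exact hne (by rw [Fin.ext (q_inj this)])
    · have := nf t0 t1.le c s0 (X_bd _) (X_bd _) (tx.symm.trans sx)
      exact Or.inl ⟨m, a, b, this.1, this.2⟩
    · have := nf s0 s1.le c t0 (X_bd _) (X_bd _) (sx.symm.trans tx)
      exact Or.inr ⟨m, a, b, this.1, this.2⟩
  · rintro rfl rfl
    rw [ty]
    exact y34 t0 t1 s0 (ty.symm.trans sy) (tx.symm.trans sx)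
  · rintro rfl rfl
    rw [sy]
    exact y34 s0 s1 t0 (sy.symm.trans ty) (sx.symm.trans tx)
  · rintro rfl
    rw [ty, hH]; linarith
  · rintro rfl
    rw [sy, hH]; linarith

theorem lac {l : Fin n} {i : Fin 4} {k : Fin 5} {p : ℝ × ℝ}
    (h : K.drawing.IsCrossing s(K.P 0, K.P i.succ) s(K.C l, K.P k) p) :
    ((i = 1 ∧ k = 1) ∨ (i = 3 ∧ k = 3)) ∧ (l : ℕ) % 2 = 1 := by
  obtain ⟨-, -, hne, h1, h2, h1', h2'⟩ := h
  obtain ⟨t, t0, t1, tx, ty⟩ := K.crA h1 h1'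
  obtain ⟨s, s0, s1, sx, sy⟩ := K.crC h2 h2'
  exact ac t0 t1 s0 s1 (tx.symm.trans sx) (ty.symm.trans sy)

theorem laa {i k : Fin 4} {p : ℝ × ℝ}
    (h : K.drawing.IsCrossing s(K.P 0, K.P i.succ) s(K.P 0, K.P k.succ) p) : False := by
  obtain ⟨-, -, hne, h1, h2, h1', h2'⟩ := h
  obtain ⟨t, t0, t1, tx, ty⟩ := K.crA h1 h1'
  obtain ⟨s, s0, s1, sx, sy⟩ := K.crA h2 h2'
  exact hne (by rw [aa t0 s0 (tx.symm.trans sx) (ty.symm.trans sy)])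

theorem nf_ne (m : Fin 4) : near m ≠ far m := by revert m; decide

def Rel (i k : Fin 5) : Prop := (∃ m : Fin 4, i = near m ∧ k = far m) ∨ ∃ m : Fin 4, k = near m ∧ i = far m

instance (i k : Fin 5) : Decidable (Rel i k) := by unfold Rel; infer_instance

def Tri (i k r : Fin 5) : Prop := (i = 0 ∧ (k = 3 ∧ r = 4 ∨ k = 4 ∧ r = 3)) ∨
  (k = 0 ∧ (i = 3 ∧ r = 4 ∨ i = 4 ∧ r = 3)) ∨ (r = 0 ∧ (i = 3 ∧ k = 4 ∨ i = 4 ∧ k = 3))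

instance (i k r : Fin 5) : Decidable (Tri i k r) := by unfold Tri; infer_instance

theorem tri_fin : ∀ i k r : Fin 5, Rel i k → Rel k r → Rel i r → Tri i k r := by decide

theorem NF.weak {j l : ℕ} {i k : Fin 5} (h : NF j l i k ∨ NF l j k i) :
    Rel i k := by
  rcases h with ⟨m, a, b, -⟩ | ⟨m, a, b, -⟩
  · exact Or.inl ⟨m, a, b⟩
  · exact Or.inr ⟨m, a, b⟩

theorem lcc_ne {j l : Fin n} {i k : Fin 5} (h : NF j l i k ∨ NF l j k i) : i ≠ k ∧ j ≠ l := by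
  rcases h with ⟨m, rfl, rfl, h, -⟩ | ⟨m, rfl, rfl, h, -⟩
  · exact ⟨nf_ne m, fun e => by rw [e] at h; exact absurd h (lt_irrefl _)⟩
  · exact ⟨(nf_ne m).symm, fun e => by rw [e] at h; exact absurd h (lt_irrefl _)⟩

/-- every edge lies on the graph of an affine function of the height -/
theorem affC {j : Fin n} {k : Fin 5} {p : ℝ × ℝ} (h : p ∈ K.drawing.edgePoints s(K.C j, K.P k))
    (h' : p ∉ K.drawing.ends s(K.C j, K.P k)) : p.1 = q j + (X k - q j) / H k * p.2 := by
  obtain ⟨t, -, -, e1, e2⟩ := K.crC h h'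
  rw [e1, e2]
  have := H_ne k
  field_simp
  ring

theorem affA {i : Fin 4} {p : ℝ × ℝ} (h : p ∈ K.drawing.edgePoints s(K.P 0, K.P i.succ))
    (h' : p ∉ K.drawing.ends s(K.P 0, K.P i.succ)) :
    p.1 = X i.succ / (H i.succ + 1) + X i.succ / (H i.succ + 1) * p.2 := by
  obtain ⟨t, -, -, e1, e2⟩ := K.crA h h'
  rw [e1, e2]
  have : H i.succ + 1 ≠ 0 := by fin_cases i <;> simp [H] <;> norm_num
  field_simp
  ring

theorem aff_unique {α β α' β' : ℝ} (h : α ≠ α') {p p' : ℝ × ℝ} (h1 : p.1 = α + β * p.2)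
    (h2 : p.1 = α' + β' * p.2) (h3 : p'.1 = α + β * p'.2) (h4 : p'.1 = α' + β' * p'.2) : p = p' := by
  have e : (β - β') * (p.2 - p'.2) = 0 := by linear_combination h2 - h1 - h4 + h3
  have hy : p.2 = p'.2 := by
    rcases mul_eq_zero.1 e with g | g
    · exfalso
      apply h
      have : β = β' := by linarith
      subst this
      linarith
    · linarith
  ext
  · rw [h1, h3, hy]
  · exact hy

theorem good : K.drawing.IsGood where
  arc_inj := by
    intro a b hab t ht s hs e
    have h := K.pos_inj.ne hab.ne
    simp only [drawing, seg, Prod.mk.injEq] at e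
    by_contra hts
    apply h
    have h0 : t - s ≠ 0 := sub_ne_zero.2 hts
    ext
    · apply mul_left_cancel₀ h0
      linear_combination -e.1
    · apply mul_left_cancel₀ h0
      linear_combination -e.2
  adj_no_cross := by
    rintro e f ⟨a, ha, hb⟩ p hp
    rcases K.edge_cases hp.1 with ⟨i, rfl⟩ | ⟨j, i, rfl⟩ <;>
      rcases K.edge_cases hp.2.1 with ⟨k, rfl⟩ | ⟨l, k, rfl⟩
    · exact K.laa hp
    · have hc := (K.lac hp).1
      rw [Sym2.mem_iff] at ha hb
      rcases ha with rfl | rfl <;> rcases hb with h | h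
      · exact K.PC _ _ h
      · have := K.Pi h
        subst this
        rcases hc with ⟨-, h⟩ | ⟨-, h⟩ <;> exact absurd h (by decide)
      · exact K.PC _ _ h
      · have := K.Pi h
        subst this
        rcases hc with ⟨rfl, h⟩ | ⟨rfl, h⟩ <;> exact absurd h (by decide)
    · have hc := (K.lac (Topo.isCrossing_symm hp)).1
      rw [Sym2.mem_iff] at ha hb
      rcases hb with rfl | rfl <;> rcases ha with h | h
      · exact K.PC _ _ h
      · have := K.Pi h
        subst this
        rcases hc with ⟨-, h⟩ | ⟨-, h⟩ <;> exact absurd h (by decide)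
      · exact K.PC _ _ h
      · have := K.Pi h
        subst this
        rcases hc with ⟨rfl, h⟩ | ⟨rfl, h⟩ <;> exact absurd h (by decide)
    · have := lcc_ne (K.lcc hp).1
      rw [Sym2.mem_iff] at ha hb
      rcases ha with rfl | rfl <;> rcases hb with h | h
      · exact this.2 (K.Ci h)
      · exact K.PC _ _ h.symm
      · exact K.PC _ _ h
      · exact this.1 (K.Pi h)
  cross_once := by
    have key : ∀ (i : Fin 4) (l : Fin n), X i.succ / (H i.succ + 1) ≠ q l := by
      intro i l h
      rcases q_abs l with g | g <;> rw [← h] at g <;> fin_cases i <;> simp [X, H] at g <;> norm_num at g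
    intro e f p hp p' hp'
    rcases K.edge_cases hp.1 with ⟨i, rfl⟩ | ⟨j, i, rfl⟩ <;>
      rcases K.edge_cases hp.2.1 with ⟨k, rfl⟩ | ⟨l, k, rfl⟩
    · exact (K.laa hp).elim
    · obtain ⟨-, -, -, a1, a2, a3, a4⟩ := hp
      obtain ⟨-, -, -, b1, b2, b3, b4⟩ := hp'
      exact aff_unique (key i l) (K.affA a1 a3) (K.affC a2 a4) (K.affA b1 b3) (K.affC b2 b4)
    · obtain ⟨-, -, -, a1, a2, a3, a4⟩ := hp
      obtain ⟨-, -, -, b1, b2, b3, b4⟩ := hp'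
      exact aff_unique (key k j).symm (K.affC a1 a3) (K.affA a2 a4) (K.affC b1 b3) (K.affA b2 b4)
    · have hne := (lcc_ne (K.lcc hp).1).2
      obtain ⟨-, -, -, a1, a2, a3, a4⟩ := hp
      obtain ⟨-, -, -, b1, b2, b3, b4⟩ := hp'
      exact aff_unique (fun h => hne (Fin.ext (q_inj h))) (K.affC a1 a3) (K.affC a2 a4) (K.affC b1 b3)
        (K.affC b2 b4)
  no_triple := by
    have key : ∀ p (i : Fin 4) f g, K.drawing.IsCrossing s(K.P 0, K.P i.succ) f p →
        K.drawing.IsCrossing s(K.P 0, K.P i.succ) g p → ¬ K.drawing.IsCrossing f g p := by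
      intro p i f g h1 h2 h3
      rcases K.edge_cases h1.2.1 with ⟨k, rfl⟩ | ⟨l, k, rfl⟩
      · exact K.laa h1
      rcases K.edge_cases h2.2.1 with ⟨k', rfl⟩ | ⟨l', k', rfl⟩
      · exact K.laa h2
      have a := (K.lac h1).1
      have b := (K.lac h2).1
      have c := (lcc_ne (K.lcc h3).1).1
      rcases a with ⟨rfl, rfl⟩ | ⟨rfl, rfl⟩ <;> rcases b with ⟨h, rfl⟩ | ⟨h, rfl⟩ <;>
        first | exact c rfl | exact absurd h (by decide)
    rintro p e f g - - - ⟨h1, h2, h3⟩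
    rcases K.edge_cases h1.1 with ⟨i, rfl⟩ | ⟨j, i, rfl⟩
    · exact key _ _ _ _ h1 h3 h2
    rcases K.edge_cases h2.1 with ⟨k, rfl⟩ | ⟨l, k, rfl⟩
    · exact key _ _ _ _ (Topo.isCrossing_symm h1) h2 h3
    rcases K.edge_cases h3.2.1 with ⟨r, rfl⟩ | ⟨o, r, rfl⟩
    · exact key _ _ _ _ (Topo.isCrossing_symm h3) (Topo.isCrossing_symm h2) h1
    obtain ⟨w1, a1, a2, a3, a4⟩ := K.lcc h1
    obtain ⟨w2, b1, b2, b3, b4⟩ := K.lcc h2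
    obtain ⟨w3, c1, c2, c3, c4⟩ := K.lcc h3
    rcases tri_fin i k r (NF.weak w1) (NF.weak w2) (NF.weak w3) with
      ⟨h, ⟨h', h''⟩ | ⟨h', h''⟩⟩ | ⟨h, ⟨h', h''⟩ | ⟨h', h''⟩⟩ | ⟨h, ⟨h', h''⟩ | ⟨h', h''⟩⟩
    · linarith [a3 h, b1 h' h'']
    · linarith [a3 h, b2 h' h'']
    · linarith [a4 h, c1 h' h'']
    · linarith [a4 h, c2 h' h'']
    · linarith [b4 h, a1 h' h'']
    · linarith [b4 h, a2 h' h'']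

end Conf
end Up


namespace Up
open Finset

theorem sum_half (n : ℕ) : ∑ j ∈ range n, j / 2 + n / 2 = (n + 1) / 2 * (n / 2) := by
  induction n with
  | zero => simp
  | succ n ih =>
    rw [sum_range_succ]
    rcases Nat.even_or_odd' n with ⟨k, rfl | rfl⟩
    · have e1 : (2 * k + 1) / 2 = k := by omega
      have e2 : 2 * k / 2 = k := by omega
      have e3 : (2 * k + 1 + 1) / 2 = k + 1 := by omega
      rw [e1, e2] at ih
      rw [e1, e2, e3]
      nlinarith
    · have e1 : (2 * k + 1) / 2 = k := by omega
      have e3 : (2 * k + 1 + 1) / 2 = k + 1 := by omega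
      have e4 : (2 * k + 1 + 1 + 1) / 2 = k + 1 := by omega
      rw [e1, e3] at ih
      rw [e1, e3, e4]
      nlinarith

theorem card_pairs (n : ℕ) :
    ((univ : Finset (Fin n × Fin n)).filter fun x => (x.2 : ℕ) < x.1 ∧ (x.2 : ℕ) % 2 = (x.1 : ℕ) % 2).card ≤
      ∑ j ∈ range n, j / 2 := by
  have : ∑ j ∈ range n, j / 2 = ((range n).sigma fun j => range (j / 2)).card := by
    rw [card_sigma]; simp
  rw [this]
  apply card_le_card_of_injOn (fun x => (⟨x.1, (x.2 : ℕ) / 2⟩ : Σ _ : ℕ, ℕ))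
  · rintro ⟨j, l⟩ h
    simp only [coe_filter, mem_univ, true_and, Set.mem_ofPred_eq] at h
    simp only [coe_sigma, Set.mem_sigma_iff, coe_range, Set.mem_Iio]
    exact ⟨j.2, by omega⟩
  · rintro ⟨j, l⟩ h ⟨j', l'⟩ h' e
    simp only [coe_filter, mem_univ, true_and, Set.mem_ofPred_eq] at h h'
    simp only [Sigma.mk.injEq, heq_eq_eq] at e
    rw [Prod.mk.injEq]
    exact ⟨Fin.ext e.1, Fin.ext (by omega)⟩

theorem card_odd (n : ℕ) : ((univ : Finset (Fin n)).filter fun x : Fin n => (x : ℕ) % 2 = 1).card ≤ n / 2 := by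
  have : n / 2 = (range (n / 2)).card := by simp
  rw [this]
  apply card_le_card_of_injOn (fun x : Fin n => (x : ℕ) / 2)
  · intro j h
    simp only [coe_filter, mem_univ, true_and, Set.mem_ofPred_eq] at h
    simp only [coe_range, Set.mem_Iio]
    have := j.2
    omega
  · intro j h j' h' e
    simp only [coe_filter, mem_univ, true_and, Set.mem_ofPred_eq] at h h'
    simp only at e
    exact Fin.ext (by omega)

namespace Conf
variable {V : Type*} {G : SimpleGraph V} {n : ℕ} (K : Conf G n)

theorem upper [Finite V] : (K.drawing.crNum : ℤ) ≤ (Z 5 (n + 1) : ℤ) - 2 * ((n / 2 : ℕ) : ℤ) := by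
  classical
  let S1 := (univ : Finset (Fin 4)) ×ˢ
    ((univ : Finset (Fin n × Fin n)).filter fun x => (x.2 : ℕ) < x.1 ∧ (x.2 : ℕ) % 2 = (x.1 : ℕ) % 2)
  let S2 := (univ : Finset (Fin 2)) ×ˢ ((univ : Finset (Fin n)).filter fun x : Fin n => (x : ℕ) % 2 = 1)
  let φ1 : Fin 4 × (Fin n × Fin n) → Sym2 (Sym2 V) := fun x =>
    s(s(K.C x.2.1, K.P (near x.1)), s(K.C x.2.2, K.P (far x.1)))
  let φ2 : Fin 2 × Fin n → Sym2 (Sym2 V) := fun x =>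
    s(s(K.P 0, K.P ((![1, 3] : Fin 2 → Fin 4) x.1).succ), s(K.C x.2, K.P ((![1, 3] : Fin 2 → Fin 5) x.1)))
  have hac : ∀ (i : Fin 4) (l : Fin n) (k : Fin 5) p,
      K.drawing.IsCrossing s(K.P 0, K.P i.succ) s(K.C l, K.P k) p →
      s(s(K.P 0, K.P i.succ), s(K.C l, K.P k)) ∈ S2.image φ2 := by
    intro i l k p h
    obtain ⟨h1, h2⟩ := K.lac h
    rw [mem_image]
    rcases h1 with ⟨rfl, rfl⟩ | ⟨rfl, rfl⟩
    · exact ⟨(0, l), by simp [S2, h2], rfl⟩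
    · exact ⟨(1, l), by simp [S2, h2], rfl⟩
  have hsub : Prod.snd '' K.drawing.crossings G.edgeSet G.edgeSet ⊆ ↑(S1.image φ1 ∪ S2.image φ2) := by
    rintro _ ⟨⟨p, e⟩, ⟨e1, e2, h, -, -, hc⟩, rfl⟩
    simp only at h hc ⊢
    subst h
    rw [coe_union]
    rcases K.edge_cases hc.1 with ⟨i, rfl⟩ | ⟨j, i, rfl⟩ <;>
      rcases K.edge_cases hc.2.1 with ⟨k, rfl⟩ | ⟨l, k, rfl⟩
    · exact (K.laa hc).elim
    · exact Or.inr (hac _ _ _ _ hc)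
    · rw [Sym2.eq_swap]
      exact Or.inr (hac _ _ _ _ (Topo.isCrossing_symm hc))
    · left
      rw [mem_coe, mem_image]
      rcases (K.lcc hc).1 with ⟨m, rfl, rfl, a, b⟩ | ⟨m, rfl, rfl, a, b⟩
      · exact ⟨(m, (j, l)), by simp [S1, b]; exact a, rfl⟩
      · exact ⟨(m, (l, j)), by simp [S1, b]; exact a, Sym2.eq_swap⟩
  have h1 : K.drawing.crNum ≤ (S1.image φ1 ∪ S2.image φ2).card := by
    rw [Topo.crNum_eq _ K.good, ← Set.ncard_coe_finset]
    exact Set.ncard_le_ncard hsub (Set.toFinite _)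
  have h2 : (S1.image φ1 ∪ S2.image φ2).card ≤ S1.card + S2.card :=
    (card_union_le _ _).trans (add_le_add card_image_le card_image_le)
  have h3 : S1.card ≤ 4 * ∑ j ∈ range n, j / 2 := by
    simp only [S1, card_product, card_univ, Fintype.card_fin]
    exact Nat.mul_le_mul_left _ (card_pairs n)
  have h4 : S2.card ≤ 2 * (n / 2) := by
    simp only [S2, card_product, card_univ, Fintype.card_fin]
    exact Nat.mul_le_mul_left _ (card_odd n)
  have h5 := sum_half n
  have h6 : Z 5 (n + 1) = 4 * ((n + 1) / 2 * (n / 2)) := by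
    unfold Z
    simp only [Nat.add_sub_cancel]
    ring
  rw [h6]
  generalize (n + 1) / 2 * (n / 2) = T at *
  push_cast
  omega

end Conf

end Up

/-- the configuration in the complete tripartite graph -/
def triConf (n : ℕ) : Up.Conf (triK 1 4 n) n where
  P := Fin.cons ⟨0, (0 : Fin 1)⟩ (fun i : Fin 4 => ⟨1, i⟩)
  C := fun j => ⟨2, j⟩
  Pi := by
    rw [Fin.cons_injective_iff]
    refine ⟨?_, ?_⟩
    · rintro ⟨i, hi⟩
      exact absurd (congrArg Sigma.fst hi) (by simp)
    · intro i j h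
      exact eq_of_heq (Sigma.mk.inj h).2
  Ci := by
    intro i j h
    exact eq_of_heq (Sigma.mk.inj h).2
  PC := by
    intro k j h
    rcases Fin.eq_zero_or_eq_succ k with rfl | ⟨k, rfl⟩
    · exact absurd (congrArg Sigma.fst h) (by simp)
    · exact absurd (congrArg Sigma.fst h) (by simp)
  all := by
    rintro ⟨i, x⟩
    fin_cases i
    · left; exact ⟨0, by have : x = (0 : Fin 1) := Subsingleton.elim (α := Fin 1) _ _
                         rw [this]; rfl⟩
    · left; exact ⟨Fin.succ x, rfl⟩
    · right; exact ⟨x, rfl⟩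
  adj := by
    rintro ⟨i, x⟩ ⟨j, y⟩ h
    have h' : i ≠ j := h
    fin_cases i <;> fin_cases j
    · exact absurd rfl h'
    · left; exact ⟨y, by have : x = (0 : Fin 1) := Subsingleton.elim (α := Fin 1) _ _
                         rw [this]; rfl, rfl⟩
    · right; right; right; exact ⟨y, 0, rfl, by
        have : x = (0 : Fin 1) := Subsingleton.elim (α := Fin 1) _ _
        rw [this]; rfl⟩
    · right; left; exact ⟨x, by
        have : y = (0 : Fin 1) := Subsingleton.elim (α := Fin 1) _ _
        rw [this]; rfl, rfl⟩
    · exact absurd rfl h'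
    · right; right; right; exact ⟨y, Fin.succ x, rfl, rfl⟩
    · right; right; left; exact ⟨x, 0, rfl, by
        have : y = (0 : Fin 1) := Subsingleton.elim (α := Fin 1) _ _
        rw [this]; rfl⟩
    · right; right; left; exact ⟨x, Fin.succ y, rfl, rfl⟩
    · exact absurd rfl h'

theorem triFinite (n : ℕ) : Finite (Σ i : Fin 3, ![Fin 1, Fin 4, Fin n] i) := by
  have : ∀ i : Fin 3, Finite (![Fin 1, Fin 4, Fin n] i) := by
    intro i
    fin_cases i
    · exact inferInstanceAs (Finite (Fin 1))
    · exact inferInstanceAs (Finite (Fin 4))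
    · exact inferInstanceAs (Finite (Fin n))
  infer_instance

/-- For every positive integer `n`, the crossing number of the complete
tripartite graph `K_{1,4,n}` equals `Z(5,n+1) − 2⌊n/2⌋`. -/
theorem statement14 (n : ℕ) (hn : 0 < n) :
    (crossingNumber (triK 1 4 n) : ℤ) = (Z 5 (n + 1) : ℤ) - 2 * ((n / 2 : ℕ) : ℤ) := by
  have hfin := triFinite n
  have hne : {k | ∃ D : Drawing (triK 1 4 n), D.IsGood ∧ D.crNum = k}.Nonempty :=
    ⟨_, (triConf n).drawing, (triConf n).good, rfl⟩
  apply le_antisymm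
  · refine le_trans ?_ (triConf n).upper
    have : crossingNumber (triK 1 4 n) ≤ (triConf n).drawing.crNum :=
      Nat.sInf_le ⟨(triConf n).drawing, (triConf n).good, rfl⟩
    exact_mod_cast this
  · obtain ⟨D, hD, hk⟩ := Nat.sInf_mem hne
    have hk' : D.crNum = crossingNumber (triK 1 4 n) := hk
    rw [← hk']
    refine Topo.lowerD hD (⟨0, (0 : Fin 1)⟩) (fun i : Fin 4 => ⟨1, i⟩) (fun j : Fin n => ⟨2, j⟩) ?_ ?_ ?_ ?_ ?_
    · intro i j h
      exact eq_of_heq (Sigma.mk.inj h).2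
    · intro i j h
      exact eq_of_heq (Sigma.mk.inj h).2
    · intro i
      exact (by decide : (0 : Fin 3) ≠ 1)
    · intro i
      exact (by decide : (0 : Fin 3) ≠ 2)
    · intro i j
      exact (by decide : (2 : Fin 3) ≠ 1)
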